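/- arXiv:1502.07246 — 3 statements merged into one kernel-verified Lean document; each statement's English description precedes it below -/
import Mathlib

section
/- Let Y ⊆ ℝ, let f₁,…,f_M be probability densities on Y with cdfs F₁,…,F_M, and let K(y;ω,μ,ν) = b*_{μ,ν}(H(y|ω)) · h(y|ω) be the beta-calibrated pooling kernel on Θ = Δ_M × (0,1) × (0,∞). Let Π be a Borel probability measure on the space of Borel probability measures on Θ (with the weak topology) whose topological support contains every finitely supported probability measure on Θ. Suppose there is a point ω* in the interior of Δ_M such that h(·|ω*) is continuous and inf_{y∈C} h(y|ω*) > 0 for every compact set C ⊆ Y. Suppose the true density f₀ is continuous on Y, ∫ [|log(H(y|ω*))| + |log(1−H(y|ω*))|] f₀(y) dy < +∞, and KL(f₀, h(·|ω*)) < +∞. Then for every ε > 0, Π({G : KL(f₀, f_G) ≤ ε}) > 0, where f_G(y) = ∫_Θ K(y;θ) G(dθ). -/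
open MeasureTheory Set

/-- Reparametrized beta density `b*_{μ,ν}`. -/
noncomputable def betaStar (μ ν x : ℝ) : ℝ :=
  (Real.Gamma ν / (Real.Gamma (μ * ν) * Real.Gamma ((1 - μ) * ν))) *
    x ^ (μ * ν - 1) * (1 - x) ^ ((1 - μ) * ν - 1)

/-- Cdf of a density `f` on `ℝ`. -/
noncomputable def cdfOf (f : ℝ → ℝ) (y : ℝ) : ℝ := ∫ z in Iic y, f z

/-- Topological support of a measure. -/
def measureSupport {X : Type*} [TopologicalSpace X] [MeasurableSpace X]
    (μ : Measure X) : Set X :=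
  {x | ∀ U : Set X, IsOpen U → x ∈ U → 0 < μ U}

noncomputable instance {X : Type*} [MeasurableSpace X] [TopologicalSpace X]
    [OpensMeasurableSpace X] : MeasurableSpace (ProbabilityMeasure X) := borel _

/-- The parameter space `Θ = Δ_M × (0,1) × (0,∞)`. -/
def ThetaSet (M : ℕ) : Set ((Fin M → ℝ) × ℝ × ℝ) :=
  {θ | θ.1 ∈ stdSimplex ℝ (Fin M) ∧ θ.2.1 ∈ Ioo (0:ℝ) 1 ∧ 0 < θ.2.2}

/-- Beta-calibrated pooling kernel `K(y;ω,μ,ν) = b*_{μ,ν}(H(y|ω)) h(y|ω)`. -/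
noncomputable def poolKernel (M : ℕ) (f : Fin M → ℝ → ℝ) (y : ℝ) (θ : ThetaSet M) : ℝ :=
  betaStar θ.1.2.1 θ.1.2.2 (∑ m, θ.1.1 m * cdfOf (f m) y) * (∑ m, θ.1.1 m * f m y)

/-- Mixture density `f_G(y) = ∫ K(y;θ) G(dθ)`. -/
noncomputable def mixDensity (M : ℕ) (f : Fin M → ℝ → ℝ)
    (G : ProbabilityMeasure (ThetaSet M)) (y : ℝ) : ℝ :=
  ∫ θ, poolKernel M f y θ ∂(G : Measure (ThetaSet M))

open Filter Topology ProbabilityTheory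

section Density

variable {h : ℝ → ℝ}

lemma isProbabilityMeasure_withDensity_ofReal (h0 : ∀ y, 0 ≤ h y) (h1 : ∫ y, h y = 1) :
    IsProbabilityMeasure (volume.withDensity fun y => ENNReal.ofReal (h y)) := by
  constructor
  rw [withDensity_apply _ MeasurableSet.univ, Measure.restrict_univ,
    ← ofReal_integral_eq_lintegral_ofReal (integrable_of_integral_eq_one h1)
      (Eventually.of_forall h0), h1, ENNReal.ofReal_one]

lemma cdfOf_eq_cdf (h0 : ∀ y, 0 ≤ h y) (h1 : ∫ y, h y = 1) :
    cdfOf h = cdf (volume.withDensity fun y => ENNReal.ofReal (h y)) := by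
  have := isProbabilityMeasure_withDensity_ofReal h0 h1
  ext y
  rw [cdf_eq_real, measureReal_def, withDensity_apply _ measurableSet_Iic,
    ← ofReal_integral_eq_lintegral_ofReal (integrable_of_integral_eq_one h1).integrableOn
      (Eventually.of_forall h0), ENNReal.toReal_ofReal (integral_nonneg h0)]
  rfl

lemma continuous_cdf {μ : Measure ℝ} [IsProbabilityMeasure μ] [NullSingletonClass μ] :
    Continuous (cdf μ) := by
  rw [continuous_iff_continuousAt]
  intro a
  rw [(cdf μ).mono.continuousAt_iff_leftLim_eq_rightLim, (cdf μ).rightLim_eq]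
  have := (cdf μ).measure_singleton a
  rw [measure_cdf, measure_singleton, eq_comm, ENNReal.ofReal_eq_zero] at this
  exact le_antisymm ((cdf μ).mono.leftLim_le le_rfl) (by linarith)

lemma map_cdf {μ : Measure ℝ} [IsProbabilityMeasure μ] [NullSingletonClass μ] :
    μ.map (cdf μ) = volume.restrict (Icc 0 1) := by
  have hc : Continuous (cdf μ) := continuous_cdf
  have : IsProbabilityMeasure (μ.map (cdf μ)) :=
    Measure.isProbabilityMeasure_map hc.measurable.aemeasurable
  have ivt : ∀ u ∈ Ioo (0 : ℝ) 1, ∃ c, cdf μ c = u := fun u hu =>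
    mem_range_of_exists_le_of_exists_ge hc
      (((tendsto_cdf_atBot μ).eventually_le_const hu.1).exists)
      (((tendsto_cdf_atTop μ).eventually_const_le hu.2).exists)
  refine Measure.ext_of_Iic _ _ fun u => ?_
  rw [Measure.map_apply hc.measurable measurableSet_Iic, Measure.restrict_apply measurableSet_Iic]
  rcases lt_or_ge u 0 with hu | hu
  · have e1 : cdf μ ⁻¹' Iic u = ∅ := by
      ext y; simpa using hu.trans_le (cdf_nonneg μ y)
    have e2 : Iic u ∩ Icc (0 : ℝ) 1 = ∅ := by
      ext y; simp only [mem_inter_iff, mem_Iic, mem_Icc, mem_empty_iff_false, iff_false]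
      rintro ⟨a, b, -⟩; linarith
    simp [e1, e2]
  rcases le_or_gt 1 u with hu1 | hu1
  · have e1 : cdf μ ⁻¹' Iic u = univ := by
      ext y; simpa using (cdf_le_one μ y).trans hu1
    have e2 : Iic u ∩ Icc (0 : ℝ) 1 = Icc 0 1 := by
      ext y; simp only [mem_inter_iff, mem_Iic, mem_Icc, and_iff_right_iff_imp]
      rintro ⟨-, b⟩; linarith
    simp [e1, e2]
  · have e2 : Iic u ∩ Icc (0 : ℝ) 1 = Icc 0 u := by
      ext y; simp only [mem_inter_iff, mem_Iic, mem_Icc]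
      constructor
      · rintro ⟨a, b, -⟩; exact ⟨b, a⟩
      · rintro ⟨a, b⟩; exact ⟨b, a, by linarith⟩
    rw [e2, Real.volume_Icc, sub_zero]
    refine le_antisymm ?_ ?_
    · have key : μ.real (cdf μ ⁻¹' Iic u) ≤ u := by
        refine le_of_forall_gt_imp_ge_of_dense fun v hv => ?_
        rcases le_or_gt 1 v with hv1 | hv1
        · exact measureReal_le_one.trans hv1
        obtain ⟨c, hcv⟩ := ivt v ⟨hu.trans_lt hv, hv1⟩
        rw [← hcv, cdf_eq_real]
        refine measureReal_mono fun y hy => ?_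
        by_contra hyc
        have := (monotone_cdf μ) (not_le.1 hyc).le
        have h2 : cdf μ y ≤ u := hy
        linarith
      rw [← ofReal_measureReal]
      exact ENNReal.ofReal_le_ofReal key
    · rcases hu.eq_or_lt with rfl | hu0
      · simp
      obtain ⟨c, hcv⟩ := ivt u ⟨hu0, hu1⟩
      rw [← hcv, ofReal_cdf]
      exact measure_mono fun y hy => monotone_cdf μ hy

lemma continuous_cdfOf (h0 : ∀ y, 0 ≤ h y) (h1 : ∫ y, h y = 1) : Continuous (cdfOf h) := by
  have := isProbabilityMeasure_withDensity_ofReal h0 h1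
  rw [cdfOf_eq_cdf h0 h1]
  exact continuous_cdf

lemma cdfOf_mono (h0 : ∀ y, 0 ≤ h y) (h1 : ∫ y, h y = 1) : Monotone (cdfOf h) := by
  rw [cdfOf_eq_cdf h0 h1]
  exact monotone_cdf _

lemma cdfOf_mem_Icc (h0 : ∀ y, 0 ≤ h y) (h1 : ∫ y, h y = 1) (y : ℝ) :
    cdfOf h y ∈ Icc (0 : ℝ) 1 := by
  rw [cdfOf_eq_cdf h0 h1]
  exact ⟨cdf_nonneg _ y, cdf_le_one _ y⟩

/-- The probability integral transform for an absolutely continuous law. -/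
lemma map_cdfOf (h0 : ∀ y, 0 ≤ h y) (h1 : ∫ y, h y = 1) :
    (volume.withDensity fun y => ENNReal.ofReal (h y)).map (cdfOf h) =
      volume.restrict (Icc 0 1) := by
  have := isProbabilityMeasure_withDensity_ofReal h0 h1
  rw [cdfOf_eq_cdf h0 h1]
  exact map_cdf

lemma lintegral_comp_cdfOf_mul (h0 : ∀ y, 0 ≤ h y) (hm : Measurable h) (h1 : ∫ y, h y = 1)
    {φ : ℝ → ENNReal} (hφ : Measurable φ) :
    ∫⁻ y, φ (cdfOf h y) * ENNReal.ofReal (h y) = ∫⁻ u in Icc 0 1, φ u := by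
  have hHm := (continuous_cdfOf h0 h1).measurable
  rw [← map_cdfOf h0 h1, lintegral_map hφ hHm]
  refine Eq.trans ?_ (lintegral_withDensity_eq_lintegral_mul _ hm.ennreal_ofReal
    (hφ.comp hHm)).symm
  exact lintegral_congr fun y => mul_comm _ _

lemma ae_cdfOf_mem_Ioo (h0 : ∀ y, 0 ≤ h y) (hm : Measurable h) (h1 : ∫ y, h y = 1) :
    ∀ᵐ y, 0 < h y → cdfOf h y ∈ Ioo (0 : ℝ) 1 := by
  have key : ∀ c : ℝ, ∀ᵐ y, 0 < h y → cdfOf h y ≠ c := by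
    intro c
    have e : (volume.withDensity fun y => ENNReal.ofReal (h y)) (cdfOf h ⁻¹' {c}) = 0 := by
      rw [← Measure.map_apply (continuous_cdfOf h0 h1).measurable (measurableSet_singleton c),
        map_cdfOf h0 h1, measure_singleton]
    have := (ae_withDensity_iff (p := fun y => cdfOf h y ≠ c) hm.ennreal_ofReal).1
      (by rw [ae_iff]; simpa [preimage] using e)
    filter_upwards [this] with y hy hpos
    exact hy (by simpa using hpos)
  filter_upwards [key 0, key 1] with y hy0 hy1 hpos
  have := cdfOf_mem_Icc h0 h1 y
  exact ⟨lt_of_le_of_ne this.1 (hy0 hpos).symm, lt_of_le_of_ne this.2 (hy1 hpos)⟩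

/-- An integrable function dominated by a density is, in `L¹`, approximated by
`q (cdfOf h) * h` with `q` continuous and nonnegative. -/
lemma exists_continuous_approx (h0 : ∀ y, 0 ≤ h y) (hm : Measurable h) (h1 : ∫ y, h y = 1)
    {g : ℝ → ℝ} (g0 : ∀ y, 0 ≤ g y) (gm : Measurable g) (gi : Integrable g)
    (gh : ∀ y, h y = 0 → g y = 0) {κ : ℝ} (hκ : 0 < κ) :
    ∃ q : ℝ → ℝ, Continuous q ∧ (∀ u, 0 ≤ q u) ∧
      Integrable (fun y => g y - q (cdfOf h y) * h y) ∧
      ∫ y, |g y - q (cdfOf h y) * h y| ≤ κ := by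
  have hP := isProbabilityMeasure_withDensity_ofReal h0 h1
  set l := volume.withDensity fun y => ENNReal.ofReal (h y) with hl
  have hHm : Measurable (cdfOf h) := (continuous_cdfOf h0 h1).measurable
  have hcm := cdfOf_mono h0 h1
  have mapl : l.map (cdfOf h) = volume.restrict (Icc 0 1) := map_cdfOf h0 h1
  have hint : ∀ φ : ℝ → ℝ, (Integrable φ l ↔ Integrable fun y => φ y * h y) ∧
      ∫ y, φ y ∂l = ∫ y, φ y * h y := by
    intro φ
    constructor
    · rw [hl, integrable_withDensity_iff hm.ennreal_ofReal (by simp)]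
      simp_rw [ENNReal.toReal_ofReal (h0 _)]
    · rw [hl, integral_withDensity_eq_integral_toReal_smul hm.ennreal_ofReal (by simp)]
      simp_rw [ENNReal.toReal_ofReal (h0 _), smul_eq_mul, mul_comm]
  let S : Set ℝ := ⋂ a : ℚ, {y | (a : ℝ) < y → cdfOf h a < cdfOf h y}
  have hS : MeasurableSet S := by
    refine MeasurableSet.iInter fun a => ?_
    have : {y | (a : ℝ) < y → cdfOf h a < cdfOf h y} =
        Iic (a : ℝ) ∪ cdfOf h ⁻¹' Ioi (cdfOf h a) := by
      ext y; simp [imp_iff_not_or]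
    rw [this]
    exact measurableSet_Iic.union (hHm measurableSet_Ioi)
  have hSl : ∀ᵐ y ∂l, y ∈ S := by
    simp only [S, mem_iInter]
    rw [ae_all_iff]
    intro a
    have e : l (cdfOf h ⁻¹' {cdfOf h a}) = 0 := by
      rw [← Measure.map_apply hHm (measurableSet_singleton _), mapl, measure_singleton]
    rw [← compl_mem_ae_iff] at e
    filter_upwards [e] with y hy hay
    exact lt_of_le_of_ne (hcm hay.le) fun h' => hy h'.symm
  have hSinj : InjOn (cdfOf h) S := by
    have hlt : ∀ x ∈ S, ∀ y ∈ S, x < y → cdfOf h x < cdfOf h y := by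
      intro x _ y hy hxy
      obtain ⟨a, ha1, ha2⟩ := exists_rat_btwn hxy
      exact (hcm ha1.le).trans_lt (mem_iInter.1 hy a ha2)
    intro x hx y hy hxy
    rcases lt_trichotomy x y with hlt' | rfl | hlt'
    · exact absurd hxy (hlt x hx y hy hlt').ne
    · rfl
    · exact absurd hxy (hlt y hy x hx hlt').ne'
  have hemb : MeasurableEmbedding (fun x : S => cdfOf h x) := by
    have : StandardBorelSpace S := hS.standardBorel
    exact (hHm.comp measurable_subtype_coe).measurableEmbedding
      (fun x y hxy => Subtype.ext (hSinj x.2 y.2 hxy))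
  obtain ⟨G, hGm, hG⟩ := hemb.exists_measurable_extend
    (g := fun x : S => g x / h x) ((gm.div hm).comp measurable_subtype_coe) (fun _ => inferInstance)
  have hGr : ∀ᵐ y ∂l, G (cdfOf h y) = g y / h y := by
    filter_upwards [hSl] with y hy
    exact congrFun hG ⟨y, hy⟩
  have hdm : ∀ y, g y / h y * h y = g y := fun y => by
    by_cases hy : h y = 0
    · simp [hy, gh y hy]
    · field_simp
  have hri : Integrable (fun y => g y / h y) l := by
    rw [(hint _).1]; simpa only [hdm] using gi
  have hGi : Integrable G (l.map (cdfOf h)) := by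
    rw [integrable_map_measure hGm.aestronglyMeasurable hHm.aemeasurable]
    exact hri.congr (hGr.mono fun y hy => hy.symm)
  have : IsFiniteMeasure (l.map (cdfOf h)) := by rw [mapl]; infer_instance
  obtain ⟨q, hq, hqi⟩ := hGi.exists_boundedContinuous_integral_sub_le hκ
  have hqc : Continuous fun u => max (q u) 0 := q.continuous.max continuous_const
  have hqi' : Integrable (fun u => max (q u) 0) (l.map (cdfOf h)) := hqi.pos_part
  have hdi : Integrable (fun y => g y / h y - max (q (cdfOf h y)) 0) l :=
    hri.sub ((integrable_map_measure hqc.aestronglyMeasurable hHm.aemeasurable).1 hqi')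
  refine ⟨fun u => max (q u) 0, hqc, fun u => le_max_right _ _, ?_, ?_⟩
  · have := (hint _).1.1 hdi
    simpa only [sub_mul, hdm] using this
  · calc ∫ y, |g y - max (q (cdfOf h y)) 0 * h y|
        = ∫ y, |g y / h y - max (q (cdfOf h y)) 0| * h y := by
          refine integral_congr_ae (Eventually.of_forall fun y => ?_)
          simp only
          rw [← abs_of_nonneg (h0 y), ← abs_mul, abs_of_nonneg (h0 y), sub_mul, hdm]
      _ = ∫ y, |g y / h y - max (q (cdfOf h y)) 0| ∂l := ((hint _).2).symm
      _ ≤ ∫ y, ‖G (cdfOf h y) - q (cdfOf h y)‖ ∂l := by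
          refine integral_mono_ae hdi.abs ?_ ?_
          · exact ((hGi.sub hqi).norm.comp_measurable hHm)
          · filter_upwards [hGr] with y hy
            rw [hy, Real.norm_eq_abs]
            have h3 : 0 ≤ g y / h y := div_nonneg (g0 y) (h0 y)
            calc _ = |max (g y / h y) 0 - max (q (cdfOf h y)) 0| := by rw [max_eq_left h3]
              _ ≤ _ := abs_max_sub_max_le_abs _ _ _
      _ = ∫ u, ‖G u - q u‖ ∂(l.map (cdfOf h)) :=
          (integral_map hHm.aemeasurable (hGi.sub hqi).norm.aestronglyMeasurable).symm
      _ ≤ κ := hq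

end Density

section Kernel

lemma continuousOn_Gamma_Ioi : ContinuousOn Real.Gamma (Ioi 0) := fun x hx =>
  (Real.differentiableAt_Gamma fun m => by
    have h1 : (0 : ℝ) < x := hx
    have h2 : (0 : ℝ) ≤ m := m.cast_nonneg
    linarith).continuousAt.continuousWithinAt

lemma betaStar_nonneg {μ ν u : ℝ} (hμ : μ ∈ Ioo (0 : ℝ) 1) (hν : 0 < ν)
    (hu : u ∈ Icc (0 : ℝ) 1) : 0 ≤ betaStar μ ν u := by
  have h1 := Real.Gamma_pos_of_pos hν
  have h2 := Real.Gamma_pos_of_pos (mul_pos hμ.1 hν)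
  have h3 := Real.Gamma_pos_of_pos (mul_pos (sub_pos.2 hμ.2) hν)
  have h4 := Real.rpow_nonneg hu.1 (μ * ν - 1)
  have h5 := Real.rpow_nonneg (sub_nonneg.2 hu.2) ((1 - μ) * ν - 1)
  unfold betaStar
  positivity

lemma measurable_betaStar (μ ν : ℝ) : Measurable (betaStar μ ν) := by
  unfold betaStar
  fun_prop

lemma lintegral_betaStar {μ ν : ℝ} (hμ : μ ∈ Ioo (0 : ℝ) 1) (hν : 0 < ν) :
    ∫⁻ u in Icc 0 1, ENNReal.ofReal (betaStar μ ν u) = 1 := by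
  rw [← lintegral_betaPDF_eq_one (mul_pos hμ.1 hν) (mul_pos (sub_pos.2 hμ.2) hν),
    lintegral_betaPDF, Measure.restrict_congr_set Ioo_ae_eq_Icc.symm]
  simp only [betaStar, beta, one_div_div]
  rw [show μ * ν + (1 - μ) * ν = ν by ring]

variable {M : ℕ} {f : Fin M → ℝ → ℝ}

lemma pool_nonneg (f0 : ∀ m y, 0 ≤ f m y) {ω : Fin M → ℝ} (hω : ω ∈ stdSimplex ℝ (Fin M))
    (y : ℝ) : 0 ≤ ∑ m, ω m * f m y :=
  Finset.sum_nonneg fun m _ => mul_nonneg (hω.1 m) (f0 m y)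

lemma measurable_pool (fm : ∀ m, Measurable (f m)) (ω : Fin M → ℝ) :
    Measurable fun y => ∑ m, ω m * f m y :=
  Finset.measurable_sum _ fun m _ => (fm m).const_mul _

lemma integral_pool (f1 : ∀ m, ∫ y, f m y = 1) {ω : Fin M → ℝ}
    (hω : ω ∈ stdSimplex ℝ (Fin M)) : ∫ y, ∑ m, ω m * f m y = 1 := by
  rw [integral_finsetSum _ fun m _ => (integrable_of_integral_eq_one (f1 m)).const_mul _]
  simp [integral_const_mul, f1, hω.2]

lemma cdfOf_pool (f1 : ∀ m, ∫ y, f m y = 1) (ω : Fin M → ℝ) (y : ℝ) :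
    cdfOf (fun z => ∑ m, ω m * f m z) y = ∑ m, ω m * cdfOf (f m) y := by
  unfold cdfOf
  rw [integral_finsetSum _ fun m _ =>
    ((integrable_of_integral_eq_one (f1 m)).const_mul _).integrableOn]
  simp [integral_const_mul]

lemma poolKernel_eq (f1 : ∀ m, ∫ y, f m y = 1) (y : ℝ) (θ : ThetaSet M) :
    poolKernel M f y θ = betaStar θ.1.2.1 θ.1.2.2 (cdfOf (fun z => ∑ m, θ.1.1 m * f m z) y) *
      ∑ m, θ.1.1 m * f m y := by
  rw [poolKernel, cdfOf_pool f1]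

lemma poolKernel_nonneg (f0 : ∀ m y, 0 ≤ f m y) (f1 : ∀ m, ∫ y, f m y = 1) (y : ℝ)
    (θ : ThetaSet M) : 0 ≤ poolKernel M f y θ := by
  rw [poolKernel_eq f1]
  exact mul_nonneg (betaStar_nonneg θ.2.2.1 θ.2.2.2
    (cdfOf_mem_Icc (pool_nonneg f0 θ.2.1) (integral_pool f1 θ.2.1) y)) (pool_nonneg f0 θ.2.1 y)

lemma lintegral_poolKernel (f0 : ∀ m y, 0 ≤ f m y) (fm : ∀ m, Measurable (f m))
    (f1 : ∀ m, ∫ y, f m y = 1) (θ : ThetaSet M) :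
    ∫⁻ y, ENNReal.ofReal (poolKernel M f y θ) = 1 := by
  have h0 := pool_nonneg f0 θ.2.1
  have h1 := integral_pool f1 θ.2.1
  rw [← lintegral_betaStar θ.2.2.1 θ.2.2.2, ← lintegral_comp_cdfOf_mul h0
    (measurable_pool fm _) h1 (measurable_betaStar _ _).ennreal_ofReal]
  refine lintegral_congr fun y => ?_
  rw [poolKernel_eq f1, ENNReal.ofReal_mul (betaStar_nonneg θ.2.2.1 θ.2.2.2
    (cdfOf_mem_Icc h0 h1 y))]

/-- The normalizing constant of the beta density is continuous on the parameter space. -/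
lemma continuous_betaConst : Continuous fun θ : ThetaSet M =>
    Real.Gamma θ.1.2.2 / (Real.Gamma (θ.1.2.1 * θ.1.2.2) * Real.Gamma ((1 - θ.1.2.1) * θ.1.2.2)) := by
  have p1 : ∀ θ : ThetaSet M, 0 < θ.1.2.2 := fun θ => θ.2.2.2
  have p2 : ∀ θ : ThetaSet M, 0 < θ.1.2.1 * θ.1.2.2 := fun θ => mul_pos θ.2.2.1.1 θ.2.2.2
  have p3 : ∀ θ : ThetaSet M, 0 < (1 - θ.1.2.1) * θ.1.2.2 := fun θ =>
    mul_pos (sub_pos.2 θ.2.2.1.2) θ.2.2.2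
  refine (continuousOn_Gamma_Ioi.comp_continuous (by fun_prop) p1).div
    ((continuousOn_Gamma_Ioi.comp_continuous (by fun_prop) p2).mul
      (continuousOn_Gamma_Ioi.comp_continuous (by fun_prop) p3)) fun θ => ?_
  exact (mul_pos (Real.Gamma_pos_of_pos (p2 θ)) (Real.Gamma_pos_of_pos (p3 θ))).ne'

lemma measurable_poolKernel (f0 : ∀ m y, 0 ≤ f m y) (fm : ∀ m, Measurable (f m))
    (f1 : ∀ m, ∫ y, f m y = 1) :
    Measurable fun p : ℝ × ThetaSet M => poolKernel M f p.1 p.2 := by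
  have hc : ∀ m, Measurable (cdfOf (f m)) := fun m => (continuous_cdfOf (f0 m) (f1 m)).measurable
  have hH : Measurable fun p : ℝ × ThetaSet M => ∑ m, p.2.1.1 m * cdfOf (f m) p.1 := by
    fun_prop
  have hh : Measurable fun p : ℝ × ThetaSet M => ∑ m, p.2.1.1 m * f m p.1 := by
    fun_prop
  have h1 : Measurable fun p : ℝ × ThetaSet M => p.2.1.2.1 := by fun_prop
  have h2 : Measurable fun p : ℝ × ThetaSet M => p.2.1.2.2 := by fun_prop
  unfold poolKernel betaStar
  exact (((continuous_betaConst.measurable.comp measurable_snd).mul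
    (hH.pow ((h1.mul h2).sub_const 1))).mul ((hH.const_sub 1).pow
      (((h1.const_sub 1).mul h2).sub_const 1))).mul hh

lemma integrable_poolKernel_prod (f0 : ∀ m y, 0 ≤ f m y) (fm : ∀ m, Measurable (f m))
    (f1 : ∀ m, ∫ y, f m y = 1) (G : ProbabilityMeasure (ThetaSet M)) :
    Integrable (fun p : ℝ × ThetaSet M => poolKernel M f p.1 p.2)
      (volume.prod (G : Measure (ThetaSet M))) := by
  have hm := measurable_poolKernel f0 fm f1
  refine ⟨hm.aestronglyMeasurable, ?_⟩
  rw [hasFiniteIntegral_iff_ofReal (Eventually.of_forall fun p => poolKernel_nonneg f0 f1 _ _),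
    lintegral_prod_symm _ hm.ennreal_ofReal.aemeasurable]
  simp only [lintegral_poolKernel f0 fm f1]
  simp

lemma ae_integrable_poolKernel (f0 : ∀ m y, 0 ≤ f m y) (fm : ∀ m, Measurable (f m))
    (f1 : ∀ m, ∫ y, f m y = 1) (G : ProbabilityMeasure (ThetaSet M)) :
    ∀ᵐ y, Integrable (poolKernel M f y) (G : Measure (ThetaSet M)) :=
  (integrable_poolKernel_prod f0 fm f1 G).prod_right_ae

lemma integrable_mixDensity (f0 : ∀ m y, 0 ≤ f m y) (fm : ∀ m, Measurable (f m))
    (f1 : ∀ m, ∫ y, f m y = 1) (G : ProbabilityMeasure (ThetaSet M)) :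
    Integrable (mixDensity M f G) :=
  (integrable_poolKernel_prod f0 fm f1 G).integral_prod_left

end Kernel

section Local

lemma rpow_lower_bound {a a₀ x x₀ η κ ρ : ℝ} (hx₀ : 0 < x₀)
    (h1 : Real.exp (-κ) * x₀ ≤ x) (h2 : x ≤ Real.exp κ * x₀)
    (ha : |a - a₀| ≤ η) (hκ : |a| * κ ≤ ρ) :
    Real.exp (-(η * |Real.log x₀| + ρ)) * x₀ ^ a₀ ≤ x ^ a := by
  have hx : 0 < x := lt_of_lt_of_le (by positivity) h1
  have l1 : Real.log x₀ - κ ≤ Real.log x := by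
    have := Real.log_le_log (by positivity) h1
    rw [Real.log_mul (by positivity) hx₀.ne', Real.log_exp] at this
    linarith
  have l2 : Real.log x ≤ Real.log x₀ + κ := by
    have := Real.log_le_log hx h2
    rw [Real.log_mul (by positivity) hx₀.ne', Real.log_exp] at this
    linarith
  rw [Real.rpow_def_of_pos hx, Real.rpow_def_of_pos hx₀, ← Real.exp_add, Real.exp_le_exp]
  have e1 : |a * (Real.log x - Real.log x₀)| ≤ ρ := by
    rw [abs_mul]
    exact (mul_le_mul_of_nonneg_left (abs_le.2 ⟨by linarith, by linarith⟩) (abs_nonneg a)).trans hκ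
  have e2 : |(a - a₀) * Real.log x₀| ≤ η * |Real.log x₀| := by
    rw [abs_mul]
    gcongr
  have e1' := (abs_le.1 e1).1
  have e2' := (abs_le.1 e2).1
  nlinarith

variable {M : ℕ} {f : Fin M → ℝ → ℝ}

/-- Near a parameter with interior weights, the kernel is bounded below by the kernel at this
parameter, up to a factor that is controlled uniformly in `y`. -/
lemma eventually_poolKernel_ge (f0 : ∀ m y, 0 ≤ f m y) (f1 : ∀ m, ∫ y, f m y = 1)
    (θ₀ : ThetaSet M) (hθ₀ : ∀ m, 0 < θ₀.1.1 m) {η : ℝ} (hη : 0 < η) :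
    ∀ᶠ θ in 𝓝 θ₀, ∀ y, (∑ m, θ₀.1.1 m * cdfOf (f m) y) ∈ Ioo (0 : ℝ) 1 →
      Real.exp (-(η * (1 + (|Real.log (∑ m, θ₀.1.1 m * cdfOf (f m) y)| +
        |Real.log (1 - ∑ m, θ₀.1.1 m * cdfOf (f m) y)|)))) * poolKernel M f y θ₀ ≤
          poolKernel M f y θ := by
  set c : ThetaSet M → ℝ := fun θ => Real.Gamma θ.1.2.2 /
    (Real.Gamma (θ.1.2.1 * θ.1.2.2) * Real.Gamma ((1 - θ.1.2.1) * θ.1.2.2)) with hc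
  set a : ThetaSet M → ℝ := fun θ => θ.1.2.1 * θ.1.2.2 - 1 with ha
  set b : ThetaSet M → ℝ := fun θ => (1 - θ.1.2.1) * θ.1.2.2 - 1 with hb
  have cpos : ∀ θ, 0 < c θ := fun θ => div_pos (Real.Gamma_pos_of_pos θ.2.2.2)
    (mul_pos (Real.Gamma_pos_of_pos (mul_pos θ.2.2.1.1 θ.2.2.2))
      (Real.Gamma_pos_of_pos (mul_pos (sub_pos.2 θ.2.2.1.2) θ.2.2.2)))
  set ρ := η / 4 with hρ
  have ρ0 : 0 < ρ := by positivity
  set κ := ρ / (|a θ₀| + |b θ₀| + η + 1) with hκ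
  have D0 : 0 < |a θ₀| + |b θ₀| + η + 1 := by positivity
  have κ0 : 0 < κ := by positivity
  have κD : (|a θ₀| + |b θ₀| + η + 1) * κ = ρ := by rw [hκ]; field_simp
  have κρ : κ ≤ ρ := by
    have := abs_nonneg (a θ₀); have := abs_nonneg (b θ₀)
    nlinarith
  have ec : ∀ᶠ θ in 𝓝 θ₀, Real.exp (-ρ) * c θ₀ < c θ := by
    refine continuous_betaConst.continuousAt.eventually_const_lt ?_
    have : Real.exp (-ρ) < 1 := Real.exp_lt_one_iff.2 (by linarith)
    have := cpos θ₀
    show Real.exp (-ρ) * c θ₀ < c θ₀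
    nlinarith
  have ea : ∀ᶠ θ in 𝓝 θ₀, |a θ - a θ₀| < η := by
    have : Continuous fun θ => |a θ - a θ₀| := by fun_prop
    exact this.continuousAt.eventually_lt_const (by simpa using hη)
  have eb : ∀ᶠ θ in 𝓝 θ₀, |b θ - b θ₀| < η := by
    have : Continuous fun θ => |b θ - b θ₀| := by fun_prop
    exact this.continuousAt.eventually_lt_const (by simpa using hη)
  have ew1 : ∀ᶠ θ in 𝓝 θ₀, ∀ m, Real.exp (-κ) * θ₀.1.1 m < θ.1.1 m := by
    rw [eventually_all]
    intro m
    have hcont : Continuous fun θ : ThetaSet M => θ.1.1 m := by fun_prop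
    refine hcont.continuousAt.eventually_const_lt ?_
    have : Real.exp (-κ) < 1 := Real.exp_lt_one_iff.2 (by linarith)
    have := hθ₀ m
    nlinarith
  have ew2 : ∀ᶠ θ in 𝓝 θ₀, ∀ m, θ.1.1 m < Real.exp κ * θ₀.1.1 m := by
    rw [eventually_all]
    intro m
    have hcont : Continuous fun θ : ThetaSet M => θ.1.1 m := by fun_prop
    refine hcont.continuousAt.eventually_lt_const ?_
    have : 1 < Real.exp κ := Real.one_lt_exp_iff.2 κ0
    have := hθ₀ m
    nlinarith
  filter_upwards [ec, ea, eb, ew1, ew2] with θ hcθ haθ hbθ hw1 hw2 y hy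
  have hF := fun m => cdfOf_mem_Icc (f0 m) (f1 m) y
  have compl : ∀ θ : ThetaSet M, 1 - ∑ m, θ.1.1 m * cdfOf (f m) y =
      ∑ m, θ.1.1 m * (1 - cdfOf (f m) y) := fun θ => by
    simp only [mul_sub, mul_one, Finset.sum_sub_distrib, θ.2.1.2]
  have low : ∀ φ : Fin M → ℝ, (∀ m, 0 ≤ φ m) →
      Real.exp (-κ) * ∑ m, θ₀.1.1 m * φ m ≤ ∑ m, θ.1.1 m * φ m := fun φ hφ => by
    rw [Finset.mul_sum]
    refine Finset.sum_le_sum fun m _ => ?_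
    rw [← mul_assoc]
    exact mul_le_mul_of_nonneg_right (hw1 m).le (hφ m)
  have upp : ∀ φ : Fin M → ℝ, (∀ m, 0 ≤ φ m) →
      ∑ m, θ.1.1 m * φ m ≤ Real.exp κ * ∑ m, θ₀.1.1 m * φ m := fun φ hφ => by
    rw [Finset.mul_sum]
    refine Finset.sum_le_sum fun m _ => ?_
    rw [← mul_assoc]
    exact mul_le_mul_of_nonneg_right (hw2 m).le (hφ m)
  have haκ : |a θ| * κ ≤ ρ := by
    rw [← κD]
    refine mul_le_mul_of_nonneg_right ?_ κ0.le
    have := abs_sub_abs_le_abs_sub (a θ) (a θ₀); have := abs_nonneg (b θ₀); linarith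
  have hbκ : |b θ| * κ ≤ ρ := by
    rw [← κD]
    refine mul_le_mul_of_nonneg_right ?_ κ0.le
    have := abs_sub_abs_le_abs_sub (b θ) (b θ₀); have := abs_nonneg (a θ₀); linarith
  have k1 := rpow_lower_bound hy.1 (low _ fun m => (hF m).1) (upp _ fun m => (hF m).1) haθ.le haκ
  have k2 := rpow_lower_bound (x := 1 - ∑ m, θ.1.1 m * cdfOf (f m) y) (sub_pos.2 hy.2)
    (by rw [compl, compl]; exact low _ fun m => sub_nonneg.2 (hF m).2)
    (by rw [compl, compl]; exact upp _ fun m => sub_nonneg.2 (hF m).2) hbθ.le hbκ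
  have k3 : Real.exp (-ρ) * ∑ m, θ₀.1.1 m * f m y ≤ ∑ m, θ.1.1 m * f m y := by
    refine le_trans (mul_le_mul_of_nonneg_right ?_ (pool_nonneg f0 θ₀.2.1 y))
      (low _ fun m => f0 m y)
    exact Real.exp_le_exp.2 (by linarith)
  have hh0 := pool_nonneg f0 θ₀.2.1 y
  have p1 : 0 < (∑ m, θ₀.1.1 m * cdfOf (f m) y) ^ a θ₀ := Real.rpow_pos_of_pos hy.1 _
  have p2 : 0 < (1 - ∑ m, θ₀.1.1 m * cdfOf (f m) y) ^ b θ₀ :=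
    Real.rpow_pos_of_pos (sub_pos.2 hy.2) _
  have c0 := cpos θ₀
  set L1 := |Real.log (∑ m, θ₀.1.1 m * cdfOf (f m) y)|
  set L2 := |Real.log (1 - ∑ m, θ₀.1.1 m * cdfOf (f m) y)|
  have hexp : Real.exp (-(η * (1 + (L1 + L2)))) = Real.exp (-ρ) * Real.exp (-(η * L1 + ρ)) *
      Real.exp (-(η * L2 + ρ)) * Real.exp (-ρ) := by
    rw [← Real.exp_add, ← Real.exp_add, ← Real.exp_add]
    congr 1
    rw [hρ]; ring
  have m1 := mul_le_mul hcθ.le k1 (by positivity) (cpos θ).le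
  have m2 := mul_le_mul m1 k2 (by positivity) (m1.trans' (by positivity))
  have m3 := mul_le_mul m2 k3 (by positivity) (m2.trans' (by positivity))
  calc _ = _ := by
        rw [hexp]
        simp only [poolKernel, betaStar]
        show _ * ((c θ₀ * (∑ m, θ₀.1.1 m * cdfOf (f m) y) ^ a θ₀ *
          (1 - ∑ m, θ₀.1.1 m * cdfOf (f m) y) ^ b θ₀) * _) = _
        ring
    _ ≤ _ := m3
    _ = _ := rfl

lemma ProbabilityMeasure.eventually_lt_measure {Ω : Type*} [MeasurableSpace Ω] [TopologicalSpace Ω]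
    [OpensMeasurableSpace Ω] [HasOuterApproxClosed Ω] {G : ProbabilityMeasure Ω} {V : Set Ω}
    (hV : IsOpen V) {c : ENNReal} (hc : c < (G : Measure Ω) V) :
    ∀ᶠ G' : ProbabilityMeasure Ω in 𝓝 G, c < (G' : Measure Ω) V :=
  eventually_lt_of_lt_liminf
    (hc.trans_le (ProbabilityMeasure.le_liminf_measure_open_of_tendsto tendsto_id hV))

/-- The mixture density of a mixing measure weakly close to a finitely supported one is bounded
below by the finite mixture, up to a factor that is controlled uniformly in `y`. -/
lemma eventually_mixDensity_ge (f0 : ∀ m y, 0 ≤ f m y) (f1 : ∀ m, ∫ y, f m y = 1)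
    {ωs : Fin M → ℝ} (hωs : ∀ m, 0 < ωs m) {ι : Type*} [Fintype ι] {θ : ι → ThetaSet M}
    (hθinj : Function.Injective θ) (hθ : ∀ i, (θ i).1.1 = ωs) {w : ι → ℝ} (hw : ∀ i, 0 < w i)
    {G : ProbabilityMeasure (ThetaSet M)}
    (hG : ∀ i V, IsOpen V → θ i ∈ V → ENNReal.ofReal (w i) ≤ (G : Measure (ThetaSet M)) V)
    {η : ℝ} (hη : 0 < η) :
    ∀ᶠ G' : ProbabilityMeasure (ThetaSet M) in 𝓝 G, ∀ y,
      (∑ m, ωs m * cdfOf (f m) y) ∈ Ioo (0 : ℝ) 1 →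
      Integrable (poolKernel M f y) (G' : Measure (ThetaSet M)) →
      Real.exp (-(η * (2 + (|Real.log (∑ m, ωs m * cdfOf (f m) y)| +
        |Real.log (1 - ∑ m, ωs m * cdfOf (f m) y)|)))) * ∑ i, w i * poolKernel M f y (θ i) ≤
          mixDensity M f G' y := by
  obtain ⟨U, hU, hUd⟩ := (finite_range θ).t2_separation
  have hV : ∀ i, ∃ V ⊆ U (θ i), IsOpen V ∧ θ i ∈ V ∧ ∀ τ ∈ V, ∀ y,
      (∑ m, ωs m * cdfOf (f m) y) ∈ Ioo (0 : ℝ) 1 →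
      Real.exp (-(η * (1 + (|Real.log (∑ m, ωs m * cdfOf (f m) y)| +
        |Real.log (1 - ∑ m, ωs m * cdfOf (f m) y)|)))) * poolKernel M f y (θ i) ≤
          poolKernel M f y τ := by
    intro i
    have h1 := eventually_poolKernel_ge f0 f1 (θ i) (by rw [hθ i]; exact hωs) hη
    rw [hθ i] at h1
    obtain ⟨V, hV, hVo, hVi⟩ := mem_nhds_iff.1
      (inter_mem h1 ((hU (θ i)).2.mem_nhds (hU (θ i)).1))
    exact ⟨V, fun τ hτ => (hV hτ).2, hVo, hVi, fun τ hτ => (hV hτ).1⟩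
  choose V hVU hVo hVi hVK using hV
  have hVd : Pairwise (Function.onFun Disjoint V) := fun i j hij =>
    (hUd (mem_range_self i) (mem_range_self j) (hθinj.ne hij)).mono (hVU i) (hVU j)
  have ev : ∀ᶠ G' : ProbabilityMeasure (ThetaSet M) in 𝓝 G, ∀ i,
      ENNReal.ofReal (Real.exp (-η) * w i) < (G' : Measure (ThetaSet M)) (V i) := by
    rw [eventually_all]
    intro i
    refine ProbabilityMeasure.eventually_lt_measure (hVo i)
      (lt_of_lt_of_le ?_ (hG i (V i) (hVo i) (hVi i)))
    rw [ENNReal.ofReal_lt_ofReal_iff (hw i)]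
    have : Real.exp (-η) < 1 := Real.exp_lt_one_iff.2 (by linarith)
    have := hw i
    nlinarith
  filter_upwards [ev] with G' hG' y hy hint
  set A := |Real.log (∑ m, ωs m * cdfOf (f m) y)| + |Real.log (1 - ∑ m, ωs m * cdfOf (f m) y)|
  calc Real.exp (-(η * (2 + A))) * ∑ i, w i * poolKernel M f y (θ i)
      = ∑ i, (Real.exp (-(η * (1 + A))) * poolKernel M f y (θ i)) * (Real.exp (-η) * w i) := by
        rw [show -(η * (2 + A)) = -(η * (1 + A)) + -η by ring, Real.exp_add, Finset.mul_sum]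
        exact Finset.sum_congr rfl fun i _ => by ring
    _ ≤ ∑ i, (Real.exp (-(η * (1 + A))) * poolKernel M f y (θ i)) *
          (G' : Measure (ThetaSet M)).real (V i) := by
        refine Finset.sum_le_sum fun i _ => mul_le_mul_of_nonneg_left ?_
          (mul_nonneg (Real.exp_pos _).le (poolKernel_nonneg f0 f1 y _))
        exact (ENNReal.ofReal_le_iff_le_toReal (measure_ne_top _ _)).1 (hG' i).le
    _ ≤ ∑ i, ∫ τ in V i, poolKernel M f y τ ∂(G' : Measure (ThetaSet M)) :=
        Finset.sum_le_sum fun i _ => setIntegral_ge_of_const_le_real (hVo i).measurableSet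
          (measure_ne_top _ _) (fun τ hτ => hVK i τ hτ y hy) hint.integrableOn
    _ = ∫ τ in ⋃ i, V i, poolKernel M f y τ ∂(G' : Measure (ThetaSet M)) :=
        (integral_iUnion_fintype (fun i => (hVo i).measurableSet) hVd
          fun i => hint.integrableOn).symm
    _ ≤ mixDensity M f G' y :=
        setIntegral_le_integral hint (Eventually.of_forall fun τ => poolKernel_nonneg f0 f1 y τ)

end Local

section BernsteinMixture

/-- The mean parameter of the beta law with integer shape parameters `k + 1` and `n - k + 1`. -/
noncomputable def bernsteinMean (n k : ℕ) : ℝ := (k + 1) / (n + 2)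

lemma bernsteinMean_mem {n k : ℕ} (hk : k ≤ n) : bernsteinMean n k ∈ Ioo (0 : ℝ) 1 := by
  have : (k : ℝ) ≤ n := by exact_mod_cast hk
  unfold bernsteinMean
  refine ⟨by positivity, ?_⟩
  rw [div_lt_one (by positivity)]
  linarith

lemma betaStar_bernsteinMean {n k : ℕ} (hk : k ≤ n) (u : ℝ) :
    betaStar (bernsteinMean n k) (n + 2) u =
      (n + 1) * (n.choose k * u ^ k * (1 - u) ^ (n - k)) := by
  have e1 : bernsteinMean n k * (n + 2) = (k : ℝ) + 1 := by
    unfold bernsteinMean; field_simp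
  have e2 : (1 - bernsteinMean n k) * (n + 2) = ((n - k : ℕ) : ℝ) + 1 := by
    rw [sub_mul, e1, Nat.cast_sub hk]; ring
  have e3 : Real.Gamma ((n : ℝ) + 2) = (n + 1) * n.factorial := by
    rw [show (n : ℝ) + 2 = ((n + 1 : ℕ) : ℝ) + 1 by push_cast; ring, Real.Gamma_nat_eq_factorial,
      Nat.factorial_succ]
    push_cast; rfl
  rw [betaStar, e1, e2, e3, Real.Gamma_nat_eq_factorial, Real.Gamma_nat_eq_factorial,
    add_sub_cancel_right, add_sub_cancel_right, Real.rpow_natCast, Real.rpow_natCast,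
    Nat.cast_choose ℝ hk]
  ring

/-- Positive mixtures of beta densities with integer shape parameters approximate `δ + q`
uniformly on the unit interval, while staying above `δ`. -/
lemma exists_bernstein_mixture {q : ℝ → ℝ} (hq : Continuous q) (q0 : ∀ u, 0 ≤ q u) {δ κ : ℝ}
    (hδ : 0 < δ) (hκ : 0 < κ) :
    ∃ (n : ℕ) (w : Fin (n + 1) → ℝ), (∀ k, 0 < w k) ∧ ∀ u ∈ Icc (0 : ℝ) 1,
      δ ≤ ∑ k, w k * betaStar (bernsteinMean n k) (n + 2) u ∧
      |∑ k, w k * betaStar (bernsteinMean n k) (n + 2) u - δ - q u| ≤ κ := by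
  let Q : C(unitInterval, ℝ) := ⟨fun x => δ + q x, by fun_prop⟩
  obtain ⟨n, hn⟩ := ((Metric.tendsto_nhds.1 (bernsteinApproximation_uniform Q)) κ hκ).exists
  refine ⟨n, fun k => Q (bernstein.z k) / (n + 1), fun k => ?_, fun u hu => ?_⟩
  · have : 0 < Q (bernstein.z k) := add_pos_of_pos_of_nonneg hδ (q0 _)
    positivity
  have e : ∑ k : Fin (n + 1), Q (bernstein.z k) / (n + 1) *
      betaStar (bernsteinMean n k) (n + 2) u = bernsteinApproximation n Q ⟨u, hu⟩ := by
    rw [bernsteinApproximation.apply]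
    refine Finset.sum_congr rfl fun k _ => ?_
    rw [betaStar_bernsteinMean (Nat.lt_succ_iff.1 k.2), bernstein_apply, smul_eq_mul]
    field_simp
  rw [e]
  constructor
  · rw [bernsteinApproximation.apply]
    calc δ = ∑ k : Fin (n + 1), bernstein n k ⟨u, hu⟩ * δ := by
          rw [← Finset.sum_mul, bernstein.probability, one_mul]
      _ ≤ _ := Finset.sum_le_sum fun k _ => mul_le_mul_of_nonneg_left
          (le_add_of_nonneg_right (q0 _)) bernstein_nonneg
  · have := (ContinuousMap.dist_apply_le_dist (f := bernsteinApproximation n Q) (g := Q)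
      ⟨u, hu⟩).trans hn.le
    rw [Real.dist_eq] at this
    rw [sub_sub]
    exact this

end BernsteinMixture

section KullbackLeibler

variable {h : ℝ → ℝ}

lemma integrable_betaStar_comp (h0 : ∀ y, 0 ≤ h y) (hm : Measurable h) (h1 : ∫ y, h y = 1)
    {μ ν : ℝ} (hμ : μ ∈ Ioo (0 : ℝ) 1) (hν : 0 < ν) :
    Integrable (fun y => betaStar μ ν (cdfOf h y) * h y) ∧
      ∫ y, betaStar μ ν (cdfOf h y) * h y = 1 := by
  have hn : ∀ y, 0 ≤ betaStar μ ν (cdfOf h y) * h y := fun y =>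
    mul_nonneg (betaStar_nonneg hμ hν (cdfOf_mem_Icc h0 h1 y)) (h0 y)
  have hmm : Measurable fun y => betaStar μ ν (cdfOf h y) * h y :=
    ((measurable_betaStar μ ν).comp (continuous_cdfOf h0 h1).measurable).mul hm
  have e : ∫⁻ y, ENNReal.ofReal (betaStar μ ν (cdfOf h y) * h y) = 1 := by
    rw [← lintegral_betaStar hμ hν, ← lintegral_comp_cdfOf_mul h0 hm h1
      (measurable_betaStar μ ν).ennreal_ofReal]
    refine lintegral_congr fun y => ?_
    rw [ENNReal.ofReal_mul (betaStar_nonneg hμ hν (cdfOf_mem_Icc h0 h1 y))]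
  refine ⟨⟨hmm.aestronglyMeasurable, ?_⟩, ?_⟩
  · rw [hasFiniteIntegral_iff_ofReal (Eventually.of_forall hn), e]
    exact ENNReal.one_lt_top
  · rw [integral_eq_lintegral_of_nonneg_ae (Eventually.of_forall hn) hmm.aestronglyMeasurable, e,
      ENNReal.toReal_one]

lemma mul_log_div_le {g h p δ A : ℝ} (hg : 0 < g) (hh : 0 < h) (hδ : 0 < δ) (hp : δ ≤ p)
    (hA : g ≤ A * h) : g * Real.log (g / (p * h)) ≤ A / δ * |g - (p - δ) * h| := by
  have p0 : 0 < p := hδ.trans_le hp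
  have A0 : 0 < A := pos_of_mul_pos_left (hg.trans_le hA) hh.le
  have l1 := Real.log_le_sub_one_of_pos (x := g / (p * h)) (by positivity)
  have r : g / (p * h) ≤ A / δ := by
    rw [div_le_div_iff₀ (by positivity) hδ]
    have := mul_le_mul hA hp hδ.le (by positivity)
    linarith
  calc g * Real.log (g / (p * h)) ≤ g * (g / (p * h) - 1) := by gcongr
    _ = g / (p * h) * (g - p * h) := by field_simp
    _ ≤ g / (p * h) * |g - (p - δ) * h| := by
        gcongr
        refine le_trans ?_ (le_abs_self _)
        nlinarith
    _ ≤ _ := by gcongr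

/-- A density with finite Kullback–Leibler divergence from `h` is approximated, in
Kullback–Leibler divergence, by a positive mixture of beta-calibrated versions of `h`. -/
lemma exists_mixture_KL_le (h0 : ∀ y, 0 ≤ h y) (hm : Measurable h) (h1 : ∫ y, h y = 1)
    {g : ℝ → ℝ} (g0 : ∀ y, 0 ≤ g y) (gm : Measurable g) (g1 : ∫ y, g y = 1)
    (gh : ∀ y, h y = 0 → g y = 0) (hKL : Integrable fun y => g y * Real.log (g y / h y))
    {ε : ℝ} (hε : 0 < ε) :
    ∃ (n : ℕ) (w : Fin (n + 1) → ℝ) (U : ℝ → ℝ), (∀ k, 0 < w k) ∧ ∑ k, w k ≤ 1 + ε ∧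
      (∀ y, 0 < ∑ k, w k * betaStar (bernsteinMean n k) (n + 2) (cdfOf h y)) ∧
      Integrable U ∧ ∫ y, U y ≤ ε ∧ ∀ y, g y * Real.log (g y /
        ((∑ k, w k * betaStar (bernsteinMean n k) (n + 2) (cdfOf h y)) * h y)) ≤ U y := by
  have gi := integrable_of_integral_eq_one g1
  have hi := integrable_of_integral_eq_one h1
  set δ := ε / 2 with hδ
  have δ0 : 0 < δ := by positivity
  set B : ℝ → ℝ := fun y => |g y * Real.log (g y / h y)| + g y * |Real.log δ| with hB
  have Bi : Integrable B := hKL.abs.add (gi.mul_const _)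
  have B0 : ∀ y, 0 ≤ B y := fun y =>
    add_nonneg (abs_nonneg _) (mul_nonneg (g0 y) (abs_nonneg _))
  let S : ℕ → Set ℝ := fun N => {y | N * h y < g y}
  have hS : ∀ N, MeasurableSet (S N) := fun N => measurableSet_lt (hm.const_mul _) gm
  have hlim : Tendsto (fun N => ∫ y, (S N).indicator B y) atTop (𝓝 (∫ _ : ℝ, (0 : ℝ))) := by
    refine tendsto_integral_of_dominated_convergence B
      (fun N => (Bi.indicator (hS N)).aestronglyMeasurable) Bi (fun N => ?_) ?_
    · refine Eventually.of_forall fun y => ?_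
      rw [Real.norm_eq_abs, abs_of_nonneg (indicator_nonneg (fun y _ => B0 y) y)]
      exact indicator_le_self' (fun y _ => B0 y) y
    · refine Eventually.of_forall fun y => ?_
      refine tendsto_const_nhds.congr' ?_
      obtain ⟨N₀, hN₀⟩ := exists_nat_gt (g y / h y)
      filter_upwards [eventually_ge_atTop N₀] with N hN
      refine (indicator_of_notMem ?_ _).symm
      simp only [S, mem_ofPred_eq, not_lt]
      rcases (h0 y).eq_or_lt with hy | hy
      · rw [gh y hy.symm, ← hy, mul_zero]
      · rw [div_lt_iff₀ hy] at hN₀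
        have : (N₀ : ℝ) ≤ N := by exact_mod_cast hN
        nlinarith
  rw [integral_zero] at hlim
  obtain ⟨N, hN, hN1⟩ := ((hlim.eventually_le_const (show (0 : ℝ) < ε / 2 by positivity)).and
    (eventually_ge_atTop 1)).exists
  have N0 : (0 : ℝ) < N := by exact_mod_cast hN1
  set κ := min (ε / 8) (ε * δ / (4 * N)) with hκ
  have κ0 : 0 < κ := by positivity
  obtain ⟨q, hqc, q0, hqi, hqκ⟩ := exists_continuous_approx h0 hm h1 g0 gm gi gh κ0
  obtain ⟨n, w, w0, hw⟩ := exists_bernstein_mixture hqc q0 δ0 κ0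
  set p : ℝ → ℝ := fun y => ∑ k, w k * betaStar (bernsteinMean n k) (n + 2) (cdfOf h y) with hp
  have hpδ : ∀ y, δ ≤ p y := fun y => (hw _ (cdfOf_mem_Icc h0 h1 y)).1
  have hbk := fun k : Fin (n + 1) => integrable_betaStar_comp h0 hm h1
    (bernsteinMean_mem (Nat.lt_succ_iff.1 k.2)) (show (0 : ℝ) < n + 2 by positivity)
  have hph : ∀ y, p y * h y = ∑ k, w k *
      (betaStar (bernsteinMean n k) (n + 2) (cdfOf h y) * h y) := fun y => by
    simp only [hp, Finset.sum_mul, mul_assoc]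
  have pint : Integrable fun y => p y * h y := by
    simp only [hph]
    exact integrable_finsetSum _ fun k _ => (hbk k).1.const_mul _
  have psum : ∫ y, p y * h y = ∑ k, w k := by
    simp only [hph]
    rw [integral_finsetSum _ fun k _ => (hbk k).1.const_mul _]
    simp only [integral_const_mul, (hbk _).2, mul_one]
  have Di : Integrable fun y => g y - (p y - δ) * h y := by
    simp only [sub_mul]
    exact gi.sub (pint.sub (hi.const_mul _))
  have Dint : ∫ y, |g y - (p y - δ) * h y| ≤ 2 * κ := by
    calc ∫ y, |g y - (p y - δ) * h y|
        ≤ ∫ y, (|g y - q (cdfOf h y) * h y| + κ * h y) := by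
          refine integral_mono Di.abs (hqi.abs.add (hi.const_mul _)) fun y => ?_
          have e : g y - (p y - δ) * h y =
              (g y - q (cdfOf h y) * h y) - (p y - δ - q (cdfOf h y)) * h y := by ring
          show |g y - (p y - δ) * h y| ≤ |g y - q (cdfOf h y) * h y| + κ * h y
          rw [e]
          refine (abs_sub _ _).trans ?_
          rw [abs_mul (p y - δ - _), abs_of_nonneg (h0 y)]
          have := mul_le_mul_of_nonneg_right (hw _ (cdfOf_mem_Icc h0 h1 y)).2 (h0 y)
          linarith
      _ = (∫ y, |g y - q (cdfOf h y) * h y|) + κ := by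
          rw [integral_add hqi.abs (hi.const_mul _), integral_const_mul, h1, mul_one]
      _ ≤ 2 * κ := by linarith
  have κ1 : κ ≤ ε / 8 := min_le_left _ _
  have κ2 : κ ≤ ε * δ / (4 * N) := min_le_right _ _
  refine ⟨n, w, fun y => (S N).indicator B y + N / δ * |g y - (p y - δ) * h y|, w0, ?_,
    fun y => δ0.trans_le (hpδ y), (Bi.indicator (hS N)).add (Di.abs.const_mul _), ?_, fun y => ?_⟩
  · have e : ∫ y, (g y - (p y - δ) * h y) = 1 - (∑ k, w k - δ) := by
      have s1 : Integrable fun y => δ * h y := hi.const_mul _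
      have s2 : Integrable fun y => p y * h y - δ * h y := pint.sub s1
      simp only [sub_mul]
      rw [integral_sub gi s2, integral_sub pint s1, integral_const_mul, h1, g1, psum, mul_one]
    have := (neg_abs_le _).trans_eq e
    have := (abs_integral_le_integral_abs (f := fun y => g y - (p y - δ) * h y)).trans Dint
    linarith
  · rw [integral_add (Bi.indicator (hS N)) (Di.abs.const_mul _), integral_const_mul]
    have : N / δ * ∫ y, |g y - (p y - δ) * h y| ≤ ε / 2 := by
      calc N / δ * ∫ y, |g y - (p y - δ) * h y| ≤ N / δ * (2 * (ε * δ / (4 * N))) := by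
            gcongr; linarith
        _ = ε / 2 := by field_simp; norm_num
    linarith
  · show g y * Real.log (g y / (p y * h y)) ≤
      (S N).indicator B y + N / δ * |g y - (p y - δ) * h y|
    have t2 : 0 ≤ N / δ * |g y - (p y - δ) * h y| := by positivity
    have t1 : 0 ≤ (S N).indicator B y := indicator_nonneg (fun y _ => B0 y) y
    rcases (g0 y).eq_or_lt with hy | hy
    · refine le_trans (le_of_eq ?_) (add_nonneg t1 t2)
      rw [← hy, zero_mul]
    have hhy : 0 < h y := lt_of_le_of_ne (h0 y) fun h' => hy.ne' (gh y h'.symm)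
    have py : 0 < p y := δ0.trans_le (hpδ y)
    by_cases hyS : y ∈ S N
    · rw [indicator_of_mem hyS]
      refine le_add_of_le_of_nonneg ?_ t2
      have e : Real.log (g y / (p y * h y)) = Real.log (g y / h y) - Real.log (p y) := by
        rw [Real.log_div hy.ne' (by positivity), Real.log_mul py.ne' hhy.ne',
          Real.log_div hy.ne' hhy.ne']
        ring
      rw [e, mul_sub, sub_eq_add_neg, ← mul_neg]
      refine add_le_add (le_abs_self _) (mul_le_mul_of_nonneg_left ?_ hy.le)
      have := Real.log_le_log δ0 (hpδ y)
      have := neg_abs_le (Real.log δ)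
      linarith
    · rw [indicator_of_notMem hyS, zero_add]
      exact mul_log_div_le hy hhy δ0 (hpδ y) (not_lt.1 hyS)

end KullbackLeibler

section FiniteMixing

/-- The discrete probability measure with atoms `θ i` and masses proportional to `w i`. -/
lemma exists_finite_mixing {M : ℕ} {ι : Type*} [Fintype ι] (θ : ι → ThetaSet M) {w : ι → ℝ}
    (hw : ∀ i, 0 ≤ w i) (hw1 : ∑ i, w i = 1) :
    ∃ G : ProbabilityMeasure (ThetaSet M),
      (∃ s : Finset (ThetaSet M), (G : Measure (ThetaSet M)) ↑s = 1) ∧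
      ∀ i V, IsOpen V → θ i ∈ V → ENNReal.ofReal (w i) ≤ (G : Measure (ThetaSet M)) V := by
  classical
  let μ : Measure (ThetaSet M) := ∑ i, ENNReal.ofReal (w i) • Measure.dirac (θ i)
  have hμ : ∀ V, MeasurableSet V → (∀ i, θ i ∈ V) → μ V = 1 := by
    intro V hV hi
    simp only [μ, Measure.finsetSum_apply, Measure.smul_apply, Measure.dirac_apply' _ hV,
      indicator_of_mem (hi _), Pi.one_apply, smul_eq_mul, mul_one]
    rw [← ENNReal.ofReal_sum_of_nonneg fun i _ => hw i, hw1, ENNReal.ofReal_one]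
  refine ⟨⟨μ, ⟨hμ univ MeasurableSet.univ fun i => mem_univ _⟩⟩, ⟨Finset.univ.image θ, ?_⟩, ?_⟩
  · exact hμ _ (Finset.measurableSet _) fun i => by simp
  · intro i V hV hi
    show _ ≤ μ V
    simp only [μ, Measure.finsetSum_apply, Measure.smul_apply,
      Measure.dirac_apply' _ hV.measurableSet, smul_eq_mul]
    refine le_trans ?_ (Finset.single_le_sum (fun _ _ => zero_le) (Finset.mem_univ i))
    rw [indicator_of_mem hi, Pi.one_apply, mul_one]

end FiniteMixing

lemma sub_le_mul_log_div {a b : ℝ} (ha : 0 < a) (hb : 0 < b) : a - b ≤ a * Real.log (a / b) := by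
  have := mul_le_mul_of_nonneg_left (Real.one_sub_inv_le_log_of_pos (div_pos ha hb)) ha.le
  refine le_trans (le_of_eq ?_) this
  field_simp

/-- Theorem 1 (Kullback–Leibler property of the nonparametric beta-mixture calibration prior,
i.i.d. case). -/
theorem beta_mixture_calibration_KL_property
    (M : ℕ) (Y : Set ℝ) (f : Fin M → ℝ → ℝ)
    -- f₁,…,f_M are probability densities on Y with cdfs F_m = cdfOf (f m)
    (hf_nonneg : ∀ m y, 0 ≤ f m y)
    (hf_supp : ∀ m, ∀ y ∉ Y, f m y = 0)
    (hf_meas : ∀ m, Measurable (f m))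
    (hf_int : ∀ m, ∫ y, f m y = 1)
    -- ω* in the interior of Δ_M
    (ωs : Fin M → ℝ)
    (hωs : ωs ∈ stdSimplex ℝ (Fin M)) (hωs_pos : ∀ m, 0 < ωs m)
    -- h(·|ω*) continuous and bounded below away from 0 on compacts of Y
    (hcont : ContinuousOn (fun y => ∑ m, ωs m * f m y) Y)
    (hinf : ∀ C : Set ℝ, C ⊆ Y → IsCompact C →
      ∃ c > 0, ∀ y ∈ C, c ≤ ∑ m, ωs m * f m y)
    -- the true density f₀ : continuous density on Y
    (f₀ : ℝ → ℝ)
    (hf₀_nonneg : ∀ y, 0 ≤ f₀ y) (hf₀_supp : ∀ y ∉ Y, f₀ y = 0)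
    (hf₀_meas : Measurable f₀) (hf₀_int : ∫ y, f₀ y = 1)
    (hf₀_cont : ContinuousOn f₀ Y)
    -- ∫ [|log H(y|ω*)| + |log(1 − H(y|ω*))|] f₀(y) dy < ∞
    (hlog : Integrable (fun y =>
      (|Real.log (∑ m, ωs m * cdfOf (f m) y)| +
        |Real.log (1 - ∑ m, ωs m * cdfOf (f m) y)|) * f₀ y))
    -- KL(f₀, h(·|ω*)) < ∞
    (hKL : Integrable (fun y => f₀ y * Real.log (f₀ y / ∑ m, ωs m * f m y)))
    -- the prior Π on M(Θ), whose weak support contains all finitely supported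
    -- probability measures on Θ
    (Pr : Measure (ProbabilityMeasure (ThetaSet M)))
    (hPr : IsProbabilityMeasure Pr)
    (hsupp : ∀ G : ProbabilityMeasure (ThetaSet M),
      (∃ s : Finset (ThetaSet M), (G : Measure (ThetaSet M)) ↑s = 1) →
      G ∈ measureSupport Pr) :
    ∀ ε > 0, 0 < Pr {G : ProbabilityMeasure (ThetaSet M) |
      Integrable (fun y => f₀ y * Real.log (f₀ y / mixDensity M f G y)) ∧
      ∫ y, f₀ y * Real.log (f₀ y / mixDensity M f G y) ≤ ε} := by
  intro ε hε
  set h : ℝ → ℝ := fun y => ∑ m, ωs m * f m y with hh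
  have h0 : ∀ y, 0 ≤ h y := pool_nonneg hf_nonneg hωs
  have hm : Measurable h := measurable_pool hf_meas ωs
  have h1 : ∫ y, h y = 1 := integral_pool hf_int hωs
  have gh : ∀ y, h y = 0 → f₀ y = 0 := by
    intro y hy
    refine hf₀_supp y fun hyY => ?_
    obtain ⟨c, hc, hcy⟩ := hinf {y} (by simpa using hyY) isCompact_singleton
    have := hcy y rfl
    rw [show ∑ m, ωs m * f m y = h y from rfl, hy] at this
    linarith
  have hH : ∀ y, ∑ m, ωs m * cdfOf (f m) y = cdfOf h y := fun y => (cdfOf_pool hf_int ωs y).symm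
  simp only [hH] at hlog
  set A : ℝ → ℝ := fun y => |Real.log (cdfOf h y)| + |Real.log (1 - cdfOf h y)| with hA
  have A0 : ∀ y, 0 ≤ A y := fun y => add_nonneg (abs_nonneg _) (abs_nonneg _)
  have gi := integrable_of_integral_eq_one hf₀_int
  obtain ⟨n, w, U, w0, wsum, ppos, Ui, Uint, hU⟩ := exists_mixture_KL_le h0 hm h1 hf₀_nonneg
    hf₀_meas hf₀_int gh hKL (show 0 < ε / 3 by positivity)
  set p : ℝ → ℝ := fun y => ∑ k, w k * betaStar (bernsteinMean n k) (n + 2) (cdfOf h y) with hp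
  set W := ∑ k, w k with hW
  have W0 : 0 < W := Finset.sum_pos (fun k _ => w0 k) Finset.univ_nonempty
  have hmem : ∀ k : Fin (n + 1), (ωs, bernsteinMean n k, (n : ℝ) + 2) ∈ ThetaSet M := fun k =>
    ⟨hωs, bernsteinMean_mem (Nat.lt_succ_iff.1 k.2), show (0 : ℝ) < n + 2 by positivity⟩
  let θ : Fin (n + 1) → ThetaSet M := fun k => ⟨_, hmem k⟩
  have θinj : Function.Injective θ := by
    intro j k hjk
    have : bernsteinMean n j = bernsteinMean n k :=
      congrArg (fun t : ThetaSet M => t.1.2.1) hjk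
    unfold bernsteinMean at this
    rw [div_left_inj' (by positivity)] at this
    exact Fin.ext (by exact_mod_cast add_right_cancel this)
  obtain ⟨G, hGs, hG⟩ := exists_finite_mixing θ (w := fun k => w k / W)
    (fun k => (div_pos (w0 k) W0).le) (by rw [← Finset.sum_div, ← hW, div_self W0.ne'])
  set C := ∫ y, A y * f₀ y with hC
  have C0 : 0 ≤ C := integral_nonneg fun y => mul_nonneg (A0 y) (hf₀_nonneg y)
  set η := ε / (3 * (2 + C)) with hη
  have η0 : 0 < η := by positivity
  obtain ⟨O, hO, hOo, hOG⟩ := mem_nhds_iff.1 (eventually_mixDensity_ge hf_nonneg hf_int hωs_pos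
    θinj (fun k => rfl) (fun k => div_pos (w0 k) W0) hG η0)
  refine (hsupp G hGs O hOo hOG).trans_le (measure_mono fun G' hG' => ?_)
  have key := hO hG'
  simp only [mem_ofPred_eq, hH] at key
  set fG := mixDensity M f G' with hfG
  have fGi : Integrable fG := integrable_mixDensity hf_nonneg hf_meas hf_int G'
  have fG0 : ∀ y, 0 ≤ fG y := fun y => integral_nonneg fun τ =>
    poolKernel_nonneg hf_nonneg hf_int y τ
  have hsum : ∀ y, ∑ k, w k / W * poolKernel M f y (θ k) = p y * h y / W := by
    intro y
    simp only [hp, Finset.sum_mul, Finset.sum_div, poolKernel_eq hf_int]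
    exact Finset.sum_congr rfl fun k _ => by simp only [θ, hh]; ring
  have lower : ∀ᵐ y, 0 < f₀ y → Real.exp (-(η * (2 + A y))) * (p y * h y / W) ≤ fG y := by
    filter_upwards [ae_cdfOf_mem_Ioo h0 hm h1,
      ae_integrable_poolKernel hf_nonneg hf_meas hf_int G'] with y hy1 hy2 hy
    rw [← hsum]
    exact key y (hy1 (lt_of_le_of_ne (h0 y) fun h' => hy.ne' (gh y h'.symm))) hy2
  set up : ℝ → ℝ := fun y => U y + (Real.log W * f₀ y + η * (2 * f₀ y + A y * f₀ y)) with hup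
  have up1 : Integrable fun y => Real.log W * f₀ y := gi.const_mul _
  have up2 : Integrable fun y => η * (2 * f₀ y + A y * f₀ y) :=
    ((gi.const_mul 2).add hlog).const_mul η
  have upi : Integrable up := Ui.add (up1.add up2)
  have bounds : ∀ᵐ y, f₀ y - fG y ≤ f₀ y * Real.log (f₀ y / fG y) ∧
      f₀ y * Real.log (f₀ y / fG y) ≤ up y := by
    filter_upwards [lower] with y hy
    have hUy := hU y
    rcases (hf₀_nonneg y).eq_or_lt with hy0 | hy0
    · rw [← hy0] at hUy
      simp only [hup, ← hy0]
      simp only [zero_mul, mul_zero, add_zero, zero_sub, Left.neg_nonpos_iff] at hUy ⊢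
      exact ⟨fG0 y, hUy⟩
    · have hhy : 0 < h y := lt_of_le_of_ne (h0 y) fun h' => hy0.ne' (gh y h'.symm)
      have py := ppos y
      have ph : 0 < p y * h y := mul_pos py hhy
      have hl : 0 < Real.exp (-(η * (2 + A y))) * (p y * h y / W) := by positivity
      have fGy : 0 < fG y := hl.trans_le (hy hy0)
      refine ⟨sub_le_mul_log_div hy0 fGy, ?_⟩
      have e1 := Real.log_le_log hl (hy hy0)
      rw [Real.log_mul (Real.exp_pos _).ne' (by positivity), Real.log_exp,
        Real.log_div ph.ne' W0.ne'] at e1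
      rw [Real.log_div hy0.ne' ph.ne'] at hUy
      rw [Real.log_div hy0.ne' fGy.ne']
      have e2 := mul_le_mul_of_nonneg_left e1 hy0.le
      simp only [hup]
      linarith
  have φi : Integrable fun y => f₀ y * Real.log (f₀ y / fG y) := by
    refine ((gi.sub fGi).abs.add upi.abs).mono'
      (hf₀_meas.aemeasurable.mul (Real.measurable_log.comp_aemeasurable
        (hf₀_meas.aemeasurable.div fGi.aemeasurable))).aestronglyMeasurable ?_
    filter_upwards [bounds] with y hy
    simp only [Pi.add_apply, Pi.sub_apply]
    rw [Real.norm_eq_abs, abs_le]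
    have := neg_abs_le (f₀ y - fG y)
    have := le_abs_self (up y)
    have := abs_nonneg (f₀ y - fG y)
    have := abs_nonneg (up y)
    constructor <;> linarith
  refine ⟨φi, ?_⟩
  calc ∫ y, f₀ y * Real.log (f₀ y / fG y) ≤ ∫ y, up y :=
        integral_mono_ae φi upi (bounds.mono fun y hy => hy.2)
    _ = (∫ y, U y) + (Real.log W + η * (2 + C)) := by
        have hAf : Integrable fun y => A y * f₀ y := hlog
        have up3 : Integrable fun y => Real.log W * f₀ y + η * (2 * f₀ y + A y * f₀ y) :=
          up1.add up2
        simp only [hup]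
        rw [integral_add Ui up3, integral_add up1 up2, integral_const_mul,
          integral_const_mul, integral_add (gi.const_mul 2) hAf, integral_const_mul, hf₀_int,
          mul_one, mul_one]
    _ ≤ ε / 3 + (ε / 3 + ε / 3) := by
        have l1 := Real.log_le_sub_one_of_pos W0
        have l2 : η * (2 + C) = ε / 3 := by rw [hη]; field_simp
        rw [l2]
        linarith
    _ = ε := by ring
end

section
/- Let Y ⊆ ℝ, let f₁,…,f_M be probability densities on Y with cdfs F₁,…,F_M, and fix ω₀ ∈ Δ_M such that h(·|ω₀) is continuous and inf_{y∈C} h(y|ω₀) > 0 for every compact set C ⊆ Y. Consider the kernel K(y;μ,ν) = b*_{μ,ν}(H(y|ω₀)) · h(y|ω₀) on Θ = (0,1) × (0,∞), and let Π be a Borel probability measure on the space of Borel probability measures on Θ (weak topology) whose topological support contains every finitely supported probability measure on Θ. Suppose the true density f₀ is continuous on Y, ∫ [|log(H(y|ω₀))| + |log(1−H(y|ω₀))|] f₀(y) dy < +∞, and KL(f₀, h(·|ω₀)) < +∞. Then for every ε > 0, Π({G : KL(f₀, f_G) ≤ ε}) > 0, where f_G(y) = ∫_Θ K(y;μ,ν)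 G(dμ dν). -/
open MeasureTheory Set

/-- The calibration parameter space `Θ = (0,1) × (0,∞)`. -/
def ThetaCal : Set (ℝ × ℝ) := Ioo (0:ℝ) 1 ×ˢ Ioi (0:ℝ)

/-- Calibration kernel with fixed pooling weights: `K(y;μ,ν) = b*_{μ,ν}(H(y|ω₀)) h(y|ω₀)`. -/
noncomputable def calKernel (M : ℕ) (f : Fin M → ℝ → ℝ) (ω₀ : Fin M → ℝ)
    (y : ℝ) (θ : ThetaCal) : ℝ :=
  betaStar θ.1.1 θ.1.2 (∑ m, ω₀ m * cdfOf (f m) y) * (∑ m, ω₀ m * f m y)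

/-- Mixture density `f_G(y) = ∫ K(y;μ,ν) G(dμ dν)`. -/
noncomputable def calMixDensity (M : ℕ) (f : Fin M → ℝ → ℝ) (ω₀ : Fin M → ℝ)
    (G : ProbabilityMeasure ThetaCal) (y : ℝ) : ℝ :=
  ∫ θ, calKernel M f ω₀ y θ ∂(G : Measure ThetaCal)

namespace BetaCalibration

open Filter Topology

/-! ### The reparametrized beta kernel -/

lemma shape_pos (θ : ThetaCal) : 0 < θ.1.1 * θ.1.2 ∧ 0 < (1 - θ.1.1) * θ.1.2 := by
  obtain ⟨⟨m, n⟩, ⟨h0, h1⟩, h2⟩ := θ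
  exact ⟨mul_pos h0 h2, mul_pos (sub_pos.2 h1) h2⟩

/-- The normalizing constant of the reparametrized beta density. -/
noncomputable def betaConst (θ : ThetaCal) : ℝ :=
  Real.Gamma θ.1.2 / (Real.Gamma (θ.1.1 * θ.1.2) * Real.Gamma ((1 - θ.1.1) * θ.1.2))

lemma betaConst_pos (θ : ThetaCal) : 0 < betaConst θ :=
  div_pos (Real.Gamma_pos_of_pos θ.2.2)
    (mul_pos (Real.Gamma_pos_of_pos (shape_pos θ).1) (Real.Gamma_pos_of_pos (shape_pos θ).2))

lemma betaStar_eq (θ : ThetaCal) (u : ℝ) :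
    betaStar θ.1.1 θ.1.2 u =
      betaConst θ * u ^ (θ.1.1 * θ.1.2 - 1) * (1 - u) ^ ((1 - θ.1.1) * θ.1.2 - 1) := rfl

lemma betaStar_pos (θ : ThetaCal) {u : ℝ} (hu : u ∈ Ioo (0 : ℝ) 1) :
    0 < betaStar θ.1.1 θ.1.2 u := by
  rw [betaStar_eq]
  exact mul_pos (mul_pos (betaConst_pos θ) (Real.rpow_pos_of_pos hu.1 _))
    (Real.rpow_pos_of_pos (sub_pos.2 hu.2) _)

lemma log_betaStar (θ : ThetaCal) {u : ℝ} (hu : u ∈ Ioo (0 : ℝ) 1) :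
    Real.log (betaStar θ.1.1 θ.1.2 u) = Real.log (betaConst θ) +
      (θ.1.1 * θ.1.2 - 1) * Real.log u + ((1 - θ.1.1) * θ.1.2 - 1) * Real.log (1 - u) := by
  have h1 := Real.rpow_pos_of_pos hu.1 (θ.1.1 * θ.1.2 - 1)
  have h2 := Real.rpow_pos_of_pos (sub_pos.2 hu.2) ((1 - θ.1.1) * θ.1.2 - 1)
  have h0 := betaConst_pos θ
  rw [betaStar_eq, Real.log_mul (by positivity) h2.ne', Real.log_mul h0.ne' h1.ne',
    Real.log_rpow hu.1, Real.log_rpow (sub_pos.2 hu.2)]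

lemma continuousAt_Gamma {x : ℝ} (hx : 0 < x) : ContinuousAt Real.Gamma x :=
  (Real.differentiableAt_Gamma fun m =>
    ((neg_nonpos.mpr m.cast_nonneg).trans_lt hx).ne').continuousAt

lemma continuous_betaConst : Continuous betaConst := by
  have hg : ∀ {k : ThetaCal → ℝ}, Continuous k → (∀ θ, 0 < k θ) →
      Continuous fun θ => Real.Gamma (k θ) := fun hk hpos =>
    continuous_iff_continuousAt.2 fun θ =>
      ContinuousAt.comp (g := Real.Gamma) (continuousAt_Gamma (hpos θ)) hk.continuousAt
  refine Continuous.div (hg (by fun_prop) fun θ => θ.2.2)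
    ((hg (by fun_prop) fun θ => (shape_pos θ).1).mul
      (hg (by fun_prop) fun θ => (shape_pos θ).2)) fun θ => ?_
  exact (mul_pos (Real.Gamma_pos_of_pos (shape_pos θ).1)
    (Real.Gamma_pos_of_pos (shape_pos θ).2)).ne'

lemma continuous_betaStar {u : ℝ} (hu : u ∈ Ioo (0 : ℝ) 1) :
    Continuous fun θ : ThetaCal => betaStar θ.1.1 θ.1.2 u := by
  simp only [betaStar_eq]
  refine (continuous_betaConst.mul ?_).mul ?_
  · exact Continuous.rpow continuous_const (by fun_prop) fun _ => Or.inl hu.1.ne'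
  · exact Continuous.rpow continuous_const (by fun_prop) fun _ => Or.inl (sub_pos.2 hu.2).ne'

lemma measurable_betaStar :
    Measurable fun p : ℝ × ThetaCal => betaStar p.2.1.1 p.2.1.2 p.1 := by
  simp only [betaStar_eq]
  have := continuous_betaConst.measurable
  fun_prop

lemma integral_betaStar (θ : ThetaCal) :
    IntegrableOn (betaStar θ.1.1 θ.1.2) (Ioo 0 1) ∧
      ∫ u in Ioo (0 : ℝ) 1, betaStar θ.1.1 θ.1.2 u = 1 := by
  have h : ∫⁻ u in Ioo (0 : ℝ) 1, ENNReal.ofReal (betaStar θ.1.1 θ.1.2 u) = 1 := by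
    rw [← ProbabilityTheory.lintegral_betaPDF_eq_one (shape_pos θ).1 (shape_pos θ).2,
      ProbabilityTheory.lintegral_betaPDF]
    simp only [betaStar, ProbabilityTheory.beta, one_div, inv_div]
    rw [← add_mul, add_sub_cancel, one_mul]
  have hm : Measurable (betaStar θ.1.1 θ.1.2) :=
    measurable_betaStar.comp (measurable_id.prodMk measurable_const)
  have h0 : ∀ᵐ u ∂volume.restrict (Ioo (0 : ℝ) 1), 0 ≤ betaStar θ.1.1 θ.1.2 u :=
    ae_restrict_of_forall_mem measurableSet_Ioo fun u hu => (betaStar_pos θ hu).le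
  constructor
  · rw [IntegrableOn, ← lintegral_ofReal_ne_top_iff_integrable hm.aestronglyMeasurable h0, h]
    exact ENNReal.one_ne_top
  · rw [integral_eq_lintegral_of_nonneg_ae h0 hm.aestronglyMeasurable, h, ENNReal.toReal_one]

/-- The log-singularity scale `1 + |log u| + |log (1 - u)|`. -/
noncomputable def logScale (u : ℝ) : ℝ := 1 + |Real.log u| + |Real.log (1 - u)|

lemma one_le_logScale (u : ℝ) : 1 ≤ logScale u := by
  unfold logScale; linarith [abs_nonneg (Real.log u), abs_nonneg (Real.log (1 - u))]

lemma exists_abs_log_betaStar_le {K : Set ThetaCal} (hK : IsCompact K) :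
    ∃ C, 0 ≤ C ∧ ∀ θ ∈ K, ∀ u ∈ Ioo (0 : ℝ) 1,
      |Real.log (betaStar θ.1.1 θ.1.2 u)| ≤ C * logScale u := by
  obtain ⟨C, hC⟩ := hK.exists_bound_of_continuousOn
    (f := fun θ : ThetaCal => |Real.log (betaConst θ)| + |θ.1.1 * θ.1.2 - 1| +
      |(1 - θ.1.1) * θ.1.2 - 1|)
    (((continuous_betaConst.log fun θ => (betaConst_pos θ).ne').abs.add (by fun_prop)).add
      (by fun_prop)).continuousOn
  refine ⟨max C 0, le_max_right _ _, fun θ hθ u hu => ?_⟩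
  have h1 := (le_abs_self _).trans ((hC θ hθ).trans (le_max_left C 0))
  rw [log_betaStar θ hu]
  set a := Real.log (betaConst θ)
  set b := θ.1.1 * θ.1.2 - 1
  set c := (1 - θ.1.1) * θ.1.2 - 1
  have ha : |a| ≤ max C 0 := by linarith [abs_nonneg b, abs_nonneg c]
  have hb : |b| ≤ max C 0 := by linarith [abs_nonneg a, abs_nonneg c]
  have hc : |c| ≤ max C 0 := by linarith [abs_nonneg b, abs_nonneg a]
  calc |a + b * Real.log u + c * Real.log (1 - u)|
      ≤ |a| + |b| * |Real.log u| + |c| * |Real.log (1 - u)| := by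
        rw [← abs_mul, ← abs_mul]; exact abs_add_three _ _ _
    _ ≤ max C 0 * 1 + max C 0 * |Real.log u| + max C 0 * |Real.log (1 - u)| := by
        rw [mul_one]; gcongr
    _ = max C 0 * logScale u := by unfold logScale; ring

/-! ### Beta mixtures and lower semicontinuity of the Kullback–Leibler divergence -/

/-- The beta mixture density with mixing distribution `G`. -/
noncomputable def betaMix (G : ProbabilityMeasure ThetaCal) (u : ℝ) : ℝ :=
  ∫ θ, betaStar θ.1.1 θ.1.2 u ∂(G : Measure ThetaCal)

lemma measurable_betaMix (G : ProbabilityMeasure ThetaCal) : Measurable (betaMix G) :=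
  (measurable_betaStar.stronglyMeasurable.integral_prod_right'
    (ν := (G : Measure ThetaCal))).measurable

lemma integrable_betaStar_prod (G : ProbabilityMeasure ThetaCal) :
    Integrable (fun p : ℝ × ThetaCal => betaStar p.2.1.1 p.2.1.2 p.1)
      ((volume.restrict (Ioo (0 : ℝ) 1)).prod (G : Measure ThetaCal)) := by
  refine (integrable_prod_iff' measurable_betaStar.aestronglyMeasurable).2
    ⟨ae_of_all _ fun θ => (integral_betaStar θ).1, ?_⟩
  have h : ∀ θ : ThetaCal, ∫ u in Ioo (0 : ℝ) 1, ‖betaStar θ.1.1 θ.1.2 u‖ = 1 := fun θ => by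
    refine Eq.trans ?_ (integral_betaStar θ).2
    exact setIntegral_congr_fun measurableSet_Ioo fun u hu =>
      Real.norm_of_nonneg (betaStar_pos θ hu).le
  simp only [h]
  exact integrable_const 1

lemma ae_integrable_betaStar (G : ProbabilityMeasure ThetaCal) :
    ∀ᵐ u ∂volume.restrict (Ioo (0 : ℝ) 1),
      Integrable (fun θ : ThetaCal => betaStar θ.1.1 θ.1.2 u) (G : Measure ThetaCal) :=
  (integrable_betaStar_prod G).prod_right_ae

lemma integrableOn_betaMix (G : ProbabilityMeasure ThetaCal) :
    IntegrableOn (betaMix G) (Ioo 0 1) :=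
  (integrable_betaStar_prod G).integral_prod_left

lemma mul_log_div {a b : ℝ} (hb : b ≠ 0) :
    a * Real.log (a / b) = a * Real.log a - a * Real.log b := by
  rcases eq_or_ne a 0 with rfl | ha
  · simp
  · rw [Real.log_div ha hb, mul_sub]

lemma sub_le_mul_log_div {a b : ℝ} (ha : 0 ≤ a) (hb : 0 < b) :
    a - b ≤ a * Real.log (a / b) := by
  rcases ha.eq_or_lt with rfl | ha
  · simpa using hb.le
  · have h := mul_le_mul_of_nonneg_left (Real.one_sub_inv_le_log_of_pos (div_pos ha hb)) ha.le
    rwa [mul_sub, mul_one, inv_div, mul_div_cancel₀ _ ha.ne'] at h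

/-- If `G₀` is finitely supported, the divergence from `g` to the beta mixture stays below any
strict upper bound of its value at `G₀` on a weak neighbourhood of `G₀`. -/
lemma exists_isOpen_integral_mul_log_div_betaMix_le {g : ℝ → ℝ} (hg0 : ∀ u, 0 ≤ g u)
    (hgm : Measurable g) (hgi : IntegrableOn g (Ioo 0 1))
    (hent : IntegrableOn (fun u => g u * Real.log (g u)) (Ioo 0 1))
    (hlog : IntegrableOn (fun u => logScale u * g u) (Ioo 0 1))
    {G₀ : ProbabilityMeasure ThetaCal} {s : Finset ThetaCal} (hs : (G₀ : Measure ThetaCal) ↑s = 1)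
    {ε : ℝ} (hε : ∫ u in Ioo 0 1, g u * Real.log (g u / betaMix G₀ u) < ε) :
    ∃ U : Set (ProbabilityMeasure ThetaCal), IsOpen U ∧ G₀ ∈ U ∧ ∀ G ∈ U,
      IntegrableOn (fun u => g u * Real.log (g u / betaMix G u)) (Ioo 0 1) ∧
        ∫ u in Ioo 0 1, g u * Real.log (g u / betaMix G u) ≤ ε := by
  have : LocallyCompactSpace ThetaCal := (isOpen_Ioo.prod isOpen_Ioi).locallyCompactSpace
  obtain ⟨χ, hχ1, -, hχc, hχ⟩ := exists_continuous_one_zero_of_isCompact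
    s.finite_toSet.isCompact isClosed_empty (disjoint_empty _)
  obtain ⟨C, hC0, hC⟩ := exists_abs_log_betaStar_le hχc
  -- pointwise bounds for the truncated kernel
  have hbnd : ∀ u ∈ Ioo (0 : ℝ) 1, ∀ θ : ThetaCal,
      χ θ * Real.exp (-(C * logScale u)) ≤ χ θ * betaStar θ.1.1 θ.1.2 u ∧
      χ θ * betaStar θ.1.1 θ.1.2 u ≤ Real.exp (C * logScale u) := by
    intro u hu θ
    by_cases hθ : θ ∈ tsupport χ
    · have h := abs_le.1 (hC θ hθ u hu)
      have h1 := (Real.le_log_iff_exp_le (betaStar_pos θ hu)).1 h.1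
      have h2 := (Real.log_le_iff_le_exp (betaStar_pos θ hu)).1 h.2
      exact ⟨mul_le_mul_of_nonneg_left h1 (hχ θ).1,
        (mul_le_of_le_one_left (betaStar_pos θ hu).le (hχ θ).2).trans h2⟩
    · rw [image_eq_zero_of_notMem_tsupport hθ]
      simpa using (Real.exp_pos _).le
  have hnn : ∀ u ∈ Ioo (0 : ℝ) 1, ∀ θ : ThetaCal, 0 ≤ χ θ * betaStar θ.1.1 θ.1.2 u :=
    fun u hu θ => mul_nonneg (hχ θ).1 (betaStar_pos θ hu).le
  have hcont : ∀ u ∈ Ioo (0 : ℝ) 1, ∃ φ : BoundedContinuousFunction ThetaCal ℝ,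
      ∀ θ, φ θ = χ θ * betaStar θ.1.1 θ.1.2 u := fun u hu =>
    ⟨.ofNormedAddCommGroup (fun θ => χ θ * betaStar θ.1.1 θ.1.2 u)
      (χ.continuous.mul (continuous_betaStar hu)) (Real.exp (C * logScale u)) fun θ => by
        rw [Real.norm_of_nonneg (hnn u hu θ)]; exact (hbnd u hu θ).2, fun _ => rfl⟩
  obtain ⟨ψ, hψ⟩ : ∃ ψ : BoundedContinuousFunction ThetaCal ℝ, ∀ θ, ψ θ = χ θ :=
    ⟨.ofNormedAddCommGroup χ χ.continuous 1 fun θ => by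
      rw [Real.norm_of_nonneg (hχ θ).1]; exact (hχ θ).2, fun _ => rfl⟩
  have hint : ∀ G : ProbabilityMeasure ThetaCal, ∀ u ∈ Ioo (0 : ℝ) 1,
      Integrable (fun θ : ThetaCal => χ θ * betaStar θ.1.1 θ.1.2 u) (G : Measure ThetaCal) := by
    intro G u hu
    obtain ⟨φ, hφ⟩ := hcont u hu
    exact (φ.integrable (G : Measure ThetaCal)).congr (ae_of_all _ hφ)
  have hχi : ∀ G : ProbabilityMeasure ThetaCal, Integrable χ (G : Measure ThetaCal) := fun G =>
    (ψ.integrable (G : Measure ThetaCal)).congr (ae_of_all _ hψ)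
  set q : ProbabilityMeasure ThetaCal → ℝ → ℝ := fun G u =>
    ∫ θ, χ θ * betaStar θ.1.1 θ.1.2 u ∂(G : Measure ThetaCal) with hq
  have hqm : ∀ G, Measurable (q G) := fun G => by
    have h : Measurable fun p : ℝ × ThetaCal => χ p.2 * betaStar p.2.1.1 p.2.1.2 p.1 :=
      (χ.continuous.measurable.comp measurable_snd).mul measurable_betaStar
    exact (h.stronglyMeasurable.integral_prod_right' (ν := (G : Measure ThetaCal))).measurable
  have hq_tendsto : ∀ u ∈ Ioo (0 : ℝ) 1, Tendsto (fun G => q G u) (𝓝 G₀) (𝓝 (q G₀ u)) := by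
    intro u hu
    obtain ⟨φ, hφ⟩ := hcont u hu
    simpa only [hφ, id] using
      ProbabilityMeasure.tendsto_iff_forall_integral_tendsto.1 (tendsto_id (x := 𝓝 G₀)) φ
  have hae : ∀ᵐ θ ∂(G₀ : Measure ThetaCal), χ θ = 1 := by
    have h : ∀ᵐ θ ∂(G₀ : Measure ThetaCal), θ ∈ (s : Set ThetaCal) :=
      (prob_compl_eq_zero_iff s.measurableSet).2 hs
    filter_upwards [h] with θ hθ using hχ1 hθ
  have hq₀ : ∀ u, q G₀ u = betaMix G₀ u := fun u =>
    integral_congr_ae (by filter_upwards [hae] with θ hθ; rw [hθ, one_mul])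
  have hmass : ∀ᶠ G : ProbabilityMeasure ThetaCal in 𝓝 G₀,
      1 / 2 < ∫ θ, χ θ ∂(G : Measure ThetaCal) := by
    have h := ProbabilityMeasure.tendsto_iff_forall_integral_tendsto.1 (tendsto_id (x := 𝓝 G₀)) ψ
    simp only [hψ, id] at h
    refine h.eventually_const_lt ?_
    rw [integral_congr_ae hae]
    norm_num
  have hq_lower : ∀ G : ProbabilityMeasure ThetaCal,
      1 / 2 < ∫ θ, χ θ ∂(G : Measure ThetaCal) → ∀ u ∈ Ioo (0 : ℝ) 1,
        1 / 2 * Real.exp (-(C * logScale u)) ≤ q G u := by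
    intro G hG u hu
    calc 1 / 2 * Real.exp (-(C * logScale u))
        ≤ (∫ θ, χ θ ∂(G : Measure ThetaCal)) * Real.exp (-(C * logScale u)) := by gcongr
      _ = ∫ θ, χ θ * Real.exp (-(C * logScale u)) ∂(G : Measure ThetaCal) :=
          (integral_mul_const _ _).symm
      _ ≤ q G u := integral_mono ((hχi G).mul_const _) (hint G u hu) fun θ => (hbnd u hu θ).1
  have hq_upper : ∀ G : ProbabilityMeasure ThetaCal, ∀ u ∈ Ioo (0 : ℝ) 1,
      q G u ≤ Real.exp (C * logScale u) := by
    intro G u hu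
    calc q G u ≤ ∫ _, Real.exp (C * logScale u) ∂(G : Measure ThetaCal) :=
          integral_mono (hint G u hu) (integrable_const _) fun θ => (hbnd u hu θ).2
      _ = Real.exp (C * logScale u) := by simp
  have hq_pos : ∀ G : ProbabilityMeasure ThetaCal,
      1 / 2 < ∫ θ, χ θ ∂(G : Measure ThetaCal) → ∀ u ∈ Ioo (0 : ℝ) 1, 0 < q G u :=
    fun G hG u hu => lt_of_lt_of_le (by positivity) (hq_lower G hG u hu)
  have hq_log : ∀ G : ProbabilityMeasure ThetaCal,
      1 / 2 < ∫ θ, χ θ ∂(G : Measure ThetaCal) → ∀ u ∈ Ioo (0 : ℝ) 1,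
        |Real.log (q G u)| ≤ (C + 1) * logScale u := by
    intro G hG u hu
    have hp := hq_pos G hG u hu
    have h1 := Real.log_le_log (by positivity) (hq_lower G hG u hu)
    have h2 := Real.log_le_log hp (hq_upper G u hu)
    rw [Real.log_mul (by norm_num) (Real.exp_ne_zero _), Real.log_exp, one_div, Real.log_inv] at h1
    rw [Real.log_exp] at h2
    have := Real.log_two_lt_d9
    have := one_le_logScale u
    exact abs_le.2 ⟨by linarith, by linarith⟩
  have hbound : ∀ G : ProbabilityMeasure ThetaCal,
      1 / 2 < ∫ θ, χ θ ∂(G : Measure ThetaCal) → ∀ u ∈ Ioo (0 : ℝ) 1,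
        ‖g u * Real.log (q G u)‖ ≤ (C + 1) * (logScale u * g u) := by
    intro G hG u hu
    rw [norm_mul, Real.norm_of_nonneg (hg0 u), Real.norm_eq_abs]
    nlinarith [mul_le_mul_of_nonneg_left (hq_log G hG u hu) (hg0 u)]
  have hqi : ∀ G : ProbabilityMeasure ThetaCal, 1 / 2 < ∫ θ, χ θ ∂(G : Measure ThetaCal) →
      IntegrableOn (fun u => g u * Real.log (q G u)) (Ioo 0 1) := fun G hG =>
    (hlog.const_mul (C + 1)).mono' (hgm.mul (hqm G).log).aestronglyMeasurable
      (ae_restrict_of_forall_mem measurableSet_Ioo (hbound G hG))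
  have hlim : Tendsto (fun G => ∫ u in Ioo 0 1, g u * Real.log (q G u)) (𝓝 G₀)
      (𝓝 (∫ u in Ioo 0 1, g u * Real.log (q G₀ u))) := by
    refine tendsto_integral_filter_of_dominated_convergence
      (fun u => (C + 1) * (logScale u * g u)) (Eventually.of_forall fun G =>
        (hgm.mul (hqm G).log).aestronglyMeasurable) ?_ (hlog.const_mul _) ?_
    · filter_upwards [hmass] with G hG
      exact ae_restrict_of_forall_mem measurableSet_Ioo (hbound G hG)
    · refine ae_restrict_of_forall_mem measurableSet_Ioo fun u hu => ?_
      exact ((hq_tendsto u hu).log (hq_pos G₀ hmass.self_of_nhds u hu).ne').const_mul _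
  have hKL : ∀ G : ProbabilityMeasure ThetaCal, 1 / 2 < ∫ θ, χ θ ∂(G : Measure ThetaCal) →
      IntegrableOn (fun u => g u * Real.log (g u / q G u)) (Ioo 0 1) ∧
      ∫ u in Ioo 0 1, g u * Real.log (g u / q G u) =
        (∫ u in Ioo 0 1, g u * Real.log (g u)) - ∫ u in Ioo 0 1, g u * Real.log (q G u) := by
    intro G hG
    have h : EqOn (fun u => g u * Real.log (g u) - g u * Real.log (q G u))
        (fun u => g u * Real.log (g u / q G u)) (Ioo 0 1) :=
      fun u hu => (mul_log_div (hq_pos G hG u hu).ne').symm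
    refine ⟨IntegrableOn.congr_fun (hent.sub (hqi G hG)) h measurableSet_Ioo, ?_⟩
    rw [← setIntegral_congr_fun measurableSet_Ioo h, integral_sub hent (hqi G hG)]
  have hev : ∀ᶠ G : ProbabilityMeasure ThetaCal in 𝓝 G₀,
      1 / 2 < ∫ θ, χ θ ∂(G : Measure ThetaCal) ∧
      (∫ u in Ioo 0 1, g u * Real.log (g u)) - ε < ∫ u in Ioo 0 1, g u * Real.log (q G u) := by
    refine hmass.and (hlim.eventually_const_lt ?_)
    simp only [← hq₀] at hε
    linarith [(hKL G₀ hmass.self_of_nhds).2]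
  obtain ⟨U, hU, hUo, hGU⟩ := eventually_nhds_iff.1 hev
  refine ⟨U, hUo, hGU, fun G hG => ?_⟩
  obtain ⟨hm, hlt⟩ := hU G hG
  have hle : ∀ᵐ u ∂volume.restrict (Ioo (0 : ℝ) 1),
      g u - betaMix G u ≤ g u * Real.log (g u / betaMix G u) ∧
      g u * Real.log (g u / betaMix G u) ≤ g u * Real.log (g u / q G u) := by
    filter_upwards [ae_integrable_betaStar G, ae_restrict_mem measurableSet_Ioo] with u hui hu
    have hp := hq_pos G hm u hu
    have hqm : q G u ≤ betaMix G u := integral_mono (hint G u hu) hui fun θ =>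
      mul_le_of_le_one_left (betaStar_pos θ hu).le (hχ θ).2
    refine ⟨sub_le_mul_log_div (hg0 u) (hp.trans_le hqm), ?_⟩
    rw [mul_log_div hp.ne', mul_log_div (hp.trans_le hqm).ne']
    gcongr
    exact hg0 u
  have hi : IntegrableOn (fun u => g u * Real.log (g u / betaMix G u)) (Ioo 0 1) :=
    integrable_of_le_of_le
      (hgm.mul (hgm.div (measurable_betaMix G)).log).aestronglyMeasurable
      (hle.mono fun u h => h.1) (hle.mono fun u h => h.2)
      (hgi.sub (integrableOn_betaMix G)) (hKL G hm).1
  refine ⟨hi, (integral_mono_ae hi (hKL G hm).1 (hle.mono fun u h => h.2)).trans ?_⟩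
  rw [(hKL G hm).2]
  linarith

/-! ### Approximation by finite beta mixtures -/

/-- Truncation of `x` to the interval `[a, b]`. -/
noncomputable def clamp (a b x : ℝ) : ℝ := max a (min x b)

lemma le_clamp (a b x : ℝ) : a ≤ clamp a b x := le_max_left _ _

lemma clamp_le {a b : ℝ} (hab : a ≤ b) (x : ℝ) : clamp a b x ≤ b :=
  max_le hab (min_le_right _ _)

lemma abs_clamp_sub_clamp_le (a b x y : ℝ) : |clamp a b x - clamp a b y| ≤ |x - y| :=
  (abs_max_sub_max_le_max _ _ _ _).trans (max_le (by simp)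
    ((abs_min_sub_min_le_max _ _ _ _).trans (max_le le_rfl (by simp))))

lemma clamp_of_mem {a b x : ℝ} (hx : x ∈ Icc a b) : clamp a b x = x := by
  rw [clamp, min_eq_left hx.2, max_eq_right hx.1]

lemma continuous_clamp (a b : ℝ) : Continuous (clamp a b) := by
  unfold clamp; fun_prop

lemma abs_log_clamp_le {n x : ℝ} (hn : 1 ≤ n) (hx : 0 < x) :
    |Real.log (clamp n⁻¹ n x)| ≤ |Real.log x| := by
  have hn0 : 0 < n := one_pos.trans_le hn
  have hn1 : n⁻¹ ≤ n := (inv_le_one_of_one_le₀ hn).trans hn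
  rcases le_total x n⁻¹ with h | h
  · have h1 := Real.log_le_log hx h
    rw [clamp, min_eq_left (h.trans hn1), max_eq_left h]
    rw [Real.log_inv] at *
    have := Real.log_nonneg hn
    rw [abs_of_nonpos (by linarith), abs_of_nonpos (by linarith)]
    linarith
  rcases le_total x n with h' | h'
  · rw [clamp_of_mem ⟨h, h'⟩]
  · rw [clamp, min_eq_right h', max_eq_right hn1]
    have := Real.log_le_log hn0 h'
    have := Real.log_nonneg hn
    rw [abs_of_nonneg (by linarith), abs_of_nonneg (by linarith)]
    linarith

lemma integrableOn_mul_log_of_mem_Icc {g φ : ℝ → ℝ} (hgi : IntegrableOn g (Ioo 0 1))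
    (hφm : Measurable φ) {a b : ℝ} (ha : 0 < a) (hφ : ∀ u ∈ Ioo (0 : ℝ) 1, φ u ∈ Icc a b) :
    IntegrableOn (fun u => g u * Real.log (φ u)) (Ioo 0 1) := by
  refine Integrable.mul_bdd (c := |Real.log a| + |Real.log b|) hgi hφm.log.aestronglyMeasurable
    (ae_restrict_of_forall_mem measurableSet_Ioo fun u hu => ?_)
  have h1 := Real.log_le_log ha (hφ u hu).1
  have h2 := Real.log_le_log (ha.trans_le (hφ u hu).1) (hφ u hu).2
  rw [Real.norm_eq_abs]
  refine abs_le.2 ⟨?_, ?_⟩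
  · linarith [neg_abs_le (Real.log a), abs_nonneg (Real.log b)]
  · linarith [le_abs_self (Real.log b), abs_nonneg (Real.log a)]

lemma exists_clamp_approx {g : ℝ → ℝ} (hg0 : ∀ u, 0 ≤ g u)
    (hgm : Measurable g) (hgi : IntegrableOn g (Ioo 0 1)) (hg1 : ∫ u in Ioo 0 1, g u = 1)
    (hent : IntegrableOn (fun u => g u * Real.log (g u)) (Ioo 0 1)) {η : ℝ} (hη : 0 < η) :
    ∃ n : ℝ, 1 ≤ n ∧ (∫ u in Ioo 0 1, clamp n⁻¹ n (g u)) < 1 + η ∧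
      (∫ u in Ioo 0 1, g u * Real.log (g u)) - η <
        ∫ u in Ioo 0 1, g u * Real.log (clamp n⁻¹ n (g u)) := by
  have hcl : ∀ u, Tendsto (fun n : ℝ => clamp n⁻¹ n (g u)) atTop (𝓝 (g u)) := fun u => by
    have h : Tendsto (fun n : ℝ => max n⁻¹ (g u)) atTop (𝓝 (max 0 (g u))) :=
      tendsto_inv_atTop_zero.max tendsto_const_nhds
    rw [max_eq_right (hg0 u)] at h
    refine h.congr' ?_
    filter_upwards [eventually_ge_atTop (g u)] with n hn
    rw [clamp, min_eq_left hn]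
  have hm : ∀ n : ℝ, Measurable fun u => clamp n⁻¹ n (g u) := fun n =>
    (continuous_clamp _ _).measurable.comp hgm
  have h1 : Tendsto (fun n : ℝ => ∫ u in Ioo 0 1, clamp n⁻¹ n (g u)) atTop
      (𝓝 (∫ u in Ioo 0 1, g u)) := by
    refine tendsto_integral_filter_of_dominated_convergence (fun u => 1 + g u)
      (Eventually.of_forall fun n => (hm n).aestronglyMeasurable) ?_
      ((integrable_const 1).add hgi) (ae_of_all _ hcl)
    filter_upwards [eventually_ge_atTop 1] with n hn
    refine ae_of_all _ fun u => ?_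
    have hn' : n⁻¹ ≤ 1 := inv_le_one_of_one_le₀ hn
    have hp : 0 < n⁻¹ := inv_pos.2 (by linarith)
    rw [Real.norm_of_nonneg (hp.le.trans (le_clamp _ _ _))]
    exact max_le (by linarith [hg0 u]) ((min_le_left _ _).trans (by linarith))
  have h2 : Tendsto (fun n : ℝ => ∫ u in Ioo 0 1, g u * Real.log (clamp n⁻¹ n (g u))) atTop
      (𝓝 (∫ u in Ioo 0 1, g u * Real.log (g u))) := by
    refine tendsto_integral_filter_of_dominated_convergence (fun u => ‖g u * Real.log (g u)‖)
      (Eventually.of_forall fun n => (hgm.mul (hm n).log).aestronglyMeasurable) ?_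
      hent.norm (ae_of_all _ fun u => ?_)
    · filter_upwards [eventually_ge_atTop 1] with n hn
      refine ae_of_all _ fun u => ?_
      rw [norm_mul, norm_mul]
      rcases (hg0 u).eq_or_lt with h | h
      · simp [← h]
      · exact mul_le_mul_of_nonneg_left (abs_log_clamp_le hn h) (norm_nonneg _)
    · rcases (hg0 u).eq_or_lt with h | h
      · simp [← h]
      · exact ((hcl u).log h.ne').const_mul _
  rw [hg1] at h1
  obtain ⟨n, hn⟩ := ((eventually_ge_atTop 1).and ((h1.eventually_lt_const
    (lt_add_of_pos_right 1 hη)).and (h2.eventually_const_lt (sub_lt_self _ hη)))).exists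
  exact ⟨n, hn⟩

lemma abs_log_sub_log_le {a x y : ℝ} (ha : 0 < a) (hx : a ≤ x) (hy : a ≤ y) :
    |Real.log x - Real.log y| ≤ |x - y| / a := by
  have key : ∀ {x y : ℝ}, a ≤ x → a ≤ y → Real.log x - Real.log y ≤ |x - y| / a := by
    intro x y hx hy
    have hx0 := ha.trans_le hx
    have hy0 := ha.trans_le hy
    rw [← Real.log_div hx0.ne' hy0.ne']
    calc Real.log (x / y) ≤ x / y - 1 := Real.log_le_sub_one_of_pos (div_pos hx0 hy0)
      _ = (x - y) / y := by field_simp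
      _ ≤ |x - y| / y := by gcongr; exact le_abs_self _
      _ ≤ |x - y| / a := by gcongr
  refine abs_le.2 ⟨?_, key hx hy⟩
  have := key hy hx
  rw [abs_sub_comm] at this
  linarith

lemma exists_continuous_weighted_approx {g ψ : ℝ → ℝ} (hg0 : ∀ u, 0 ≤ g u) (hgm : Measurable g)
    (hgi : IntegrableOn g (Ioo 0 1)) (hψm : Measurable ψ) {a b : ℝ} (hab : a ≤ b)
    (hψ : ∀ u, ψ u ∈ Icc a b) {δ : ℝ} (hδ : 0 < δ) :
    ∃ φ : ℝ → ℝ, Continuous φ ∧ (∀ u, φ u ∈ Icc a b) ∧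
      IntegrableOn (fun u => (1 + g u) * |ψ u - φ u|) (Ioo 0 1) ∧
      ∫ u in Ioo 0 1, (1 + g u) * |ψ u - φ u| ≤ δ := by
  have h1g : IntegrableOn (fun u => 1 + g u) (Ioo 0 1) := (integrable_const 1).add hgi
  set w : ℝ → ENNReal := fun u => ENNReal.ofReal (1 + g u) with hw
  have hwm : Measurable w := (measurable_const.add hgm).ennreal_ofReal
  have hwr : ∀ u, (w u).toReal = 1 + g u := fun u =>
    ENNReal.toReal_ofReal (by linarith [hg0 u])
  have : IsFiniteMeasure ((volume.restrict (Ioo (0 : ℝ) 1)).withDensity w) :=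
    isFiniteMeasure_withDensity_ofReal h1g.2
  have hwi : ∀ {k : ℝ → ℝ} {c : ℝ}, Measurable k → (∀ u, |k u| ≤ c) →
      IntegrableOn (fun u => (1 + g u) * k u) (Ioo 0 1) := fun hk hc =>
    Integrable.mul_bdd h1g hk.aestronglyMeasurable (ae_of_all _ hc)
  have hψb : ∀ u, |ψ u| ≤ |a| + |b| := fun u => abs_le.2
    ⟨by linarith [(hψ u).1, neg_abs_le a, abs_nonneg b],
      by linarith [(hψ u).2, le_abs_self b, abs_nonneg a]⟩
  obtain ⟨φ, hφ, -⟩ := Integrable.exists_boundedContinuous_integral_sub_le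
    (Integrable.of_bound (μ := (volume.restrict (Ioo (0 : ℝ) 1)).withDensity w)
      hψm.aestronglyMeasurable _ (ae_of_all _ hψb)) hδ
  rw [integral_withDensity_eq_integral_toReal_smul hwm
    (ae_of_all _ fun _ => ENNReal.ofReal_lt_top)] at hφ
  simp only [hwr, smul_eq_mul, Real.norm_eq_abs] at hφ
  have hle : ∀ u, |ψ u - clamp a b (φ u)| ≤ |ψ u - φ u| := fun u => by
    simpa only [clamp_of_mem (hψ u)] using abs_clamp_sub_clamp_le a b (ψ u) (φ u)
  have hφb : ∀ u, |(|ψ u - φ u|)| ≤ |a| + |b| + ‖φ‖ := fun u => by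
    rw [abs_abs]
    exact (abs_sub _ _).trans (add_le_add (hψb u) (φ.norm_coe_le_norm u))
  have hcm : Continuous fun u => clamp a b (φ u) := (continuous_clamp a b).comp φ.continuous
  have hi := hwi (hψm.sub φ.continuous.measurable).abs hφb
  have hi' := hwi (hψm.sub hcm.measurable).abs fun u =>
    (abs_abs _).trans_le ((hle u).trans ((abs_abs _).symm.trans_le (hφb u)))
  refine ⟨fun u => clamp a b (φ u), hcm, fun u => ⟨le_clamp _ _ _, clamp_le hab _⟩, hi',
    le_trans (integral_mono hi' hi fun u => ?_) hφ⟩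
  exact mul_le_mul_of_nonneg_left (hle u) (by linarith [hg0 u])

lemma exists_continuous_approx {g : ℝ → ℝ} (hg0 : ∀ u, 0 ≤ g u)
    (hgm : Measurable g) (hgi : IntegrableOn g (Ioo 0 1)) (hg1 : ∫ u in Ioo 0 1, g u = 1)
    (hent : IntegrableOn (fun u => g u * Real.log (g u)) (Ioo 0 1)) {η : ℝ} (hη : 0 < η) :
    ∃ (φ : ℝ → ℝ) (a b : ℝ), Continuous φ ∧ 0 < a ∧ a ≤ 1 ∧ (∀ u, φ u ∈ Icc a b) ∧
      (∫ u in Ioo 0 1, φ u) ≤ 1 + η ∧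
      (∫ u in Ioo 0 1, g u * Real.log (g u)) - η ≤ ∫ u in Ioo 0 1, g u * Real.log (φ u) := by
  obtain ⟨n, hn, hn1, hn2⟩ := exists_clamp_approx hg0 hgm hgi hg1 hent (half_pos hη)
  have ha : 0 < n⁻¹ := inv_pos.2 (by linarith)
  have ha1 : n⁻¹ ≤ 1 := inv_le_one_of_one_le₀ hn
  set a := n⁻¹
  have hψ : ∀ u, clamp a n (g u) ∈ Icc a n := fun u => ⟨le_clamp _ _ _, clamp_le (ha1.trans hn) _⟩
  have hψm : Measurable fun u => clamp a n (g u) := (continuous_clamp _ _).measurable.comp hgm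
  obtain ⟨φ, hφc, hφ, hi, hd⟩ := exists_continuous_weighted_approx hg0 hgm hgi hψm
    (ha1.trans hn) hψ (mul_pos ha (half_pos hη))
  have hbi : ∀ {k : ℝ → ℝ}, Measurable k → (∀ u, k u ∈ Icc a n) → IntegrableOn k (Ioo 0 1) :=
    fun hk hk' => Integrable.of_bound hk.aestronglyMeasurable n (ae_of_all _ fun u => by
      rw [Real.norm_of_nonneg (ha.le.trans (hk' u).1)]; exact (hk' u).2)
  refine ⟨φ, a, n, hφc, ha, ha1, hφ, ?_, ?_⟩
  · have h : ∫ u in Ioo 0 1, (φ u - clamp a n (g u)) ≤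
        ∫ u in Ioo 0 1, (1 + g u) * |clamp a n (g u) - φ u| := by
      refine integral_mono ((hbi hφc.measurable hφ).sub (hbi hψm hψ)) hi fun u => ?_
      have h1 := neg_abs_le (clamp a n (g u) - φ u)
      have h2 := mul_nonneg (hg0 u) (abs_nonneg (clamp a n (g u) - φ u))
      simp only
      linarith
    rw [integral_sub (hbi hφc.measurable hφ) (hbi hψm hψ)] at h
    have : a * (η / 2) ≤ η / 2 := mul_le_of_le_one_left (half_pos hη).le ha1
    linarith
  · have hl1 := integrableOn_mul_log_of_mem_Icc hgi hψm ha fun u _ => hψ u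
    have hl2 := integrableOn_mul_log_of_mem_Icc hgi hφc.measurable ha fun u _ => hφ u
    have h : ∫ u in Ioo 0 1, (g u * Real.log (clamp a n (g u)) - g u * Real.log (φ u)) ≤
        ∫ u in Ioo 0 1, (1 + g u) * |clamp a n (g u) - φ u| / a := by
      refine integral_mono (hl1.sub hl2) (hi.div_const a) fun u => ?_
      have h1 := (le_abs_self _).trans (abs_log_sub_log_le ha (hψ u).1 (hφ u).1)
      have h2 := mul_le_mul_of_nonneg_left h1 (hg0 u)
      have h3 : 0 ≤ |clamp a n (g u) - φ u| / a := by positivity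
      simp only
      rw [mul_div_assoc]
      linarith
    rw [integral_sub hl1 hl2, integral_div] at h
    have : (∫ u in Ioo 0 1, (1 + g u) * |clamp a n (g u) - φ u|) / a ≤ η / 2 := by
      rw [div_le_iff₀ ha]; linarith
    linarith

/-- The parameter whose beta density is the normalized `k`-th Bernstein polynomial of degree `n`. -/
noncomputable def bernsteinParam (n : ℕ) (k : Fin (n + 1)) : ThetaCal :=
  ⟨(((k : ℝ) + 1) / (n + 2), (n : ℝ) + 2), by
    have hk : (k : ℝ) ≤ n := by exact_mod_cast Fin.is_le k
    refine ⟨⟨by positivity, ?_⟩, ?_⟩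
    · rw [div_lt_one (by positivity)]; linarith
    · exact mem_Ioi.2 (by positivity)⟩

lemma betaStar_bernsteinParam (n : ℕ) (k : Fin (n + 1)) (u : unitInterval) :
    betaStar (bernsteinParam n k).1.1 (bernsteinParam n k).1.2 u =
      (n + 1) * bernstein n k u := by
  have hk : (k : ℕ) ≤ n := Fin.is_le k
  have h1 : ((k : ℝ) + 1) / (n + 2) * (n + 2) = (k : ℕ) + 1 := by field_simp
  have h2 : (1 - ((k : ℝ) + 1) / (n + 2)) * (n + 2) = (n - k : ℕ) + 1 := by
    push_cast [hk]; field_simp; ring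
  have h3 : (n : ℝ) + 2 = (n + 1 : ℕ) + 1 := by push_cast; ring
  simp only [betaStar, bernsteinParam, bernstein_apply]
  rw [h1, h2, h3, Real.Gamma_nat_eq_factorial, Real.Gamma_nat_eq_factorial,
    Real.Gamma_nat_eq_factorial, add_sub_cancel_right, add_sub_cancel_right,
    Real.rpow_natCast, Real.rpow_natCast, Nat.cast_choose ℝ hk, Nat.factorial_succ]
  push_cast
  ring

lemma exists_bernstein_approx {φ : ℝ → ℝ} (hφ : Continuous φ) (hφ0 : ∀ u, 0 ≤ φ u)
    {τ : ℝ} (hτ : 0 < τ) :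
    ∃ (n : ℕ) (c : Fin (n + 1) → ℝ) (θ : Fin (n + 1) → ThetaCal), (∀ k, 0 ≤ c k) ∧
      ∀ u ∈ Ioo (0 : ℝ) 1, |∑ k, c k * betaStar (θ k).1.1 (θ k).1.2 u - φ u| ≤ τ := by
  let F : C(unitInterval, ℝ) := ⟨fun u => φ u, hφ.comp continuous_subtype_val⟩
  obtain ⟨n, hn⟩ := ((Metric.tendsto_nhds.1 (bernsteinApproximation_uniform F)) τ hτ).exists
  refine ⟨n, fun k => φ (bernstein.z k : unitInterval) / (n + 1), bernsteinParam n,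
    fun k => div_nonneg (hφ0 _) (by positivity), fun u hu => ?_⟩
  have h := (ContinuousMap.dist_apply_le_dist (f := bernsteinApproximation n F) (g := F)
    ⟨u, hu.1.le, hu.2.le⟩).trans hn.le
  rw [Real.dist_eq, bernsteinApproximation.apply] at h
  refine le_of_eq_of_le ?_ h
  congr 2
  refine Finset.sum_congr rfl fun k _ => ?_
  have h' := betaStar_bernsteinParam n k ⟨u, hu.1.le, hu.2.le⟩
  simp only at h'
  rw [h', smul_eq_mul]
  simp only [F, ContinuousMap.coe_mk]
  field_simp

lemma exists_finitely_supported_betaMix {n : ℕ} {c : Fin n → ℝ} (hc : ∀ k, 0 ≤ c k)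
    (hZ : 0 < ∑ k, c k) (θ : Fin n → ThetaCal) :
    ∃ (G : ProbabilityMeasure ThetaCal) (s : Finset ThetaCal), (G : Measure ThetaCal) ↑s = 1 ∧
      ∀ u, betaMix G u = (∑ k, c k * betaStar (θ k).1.1 (θ k).1.2 u) / ∑ k, c k := by
  classical
  set Z := ∑ k, c k with hZdef
  have hw : ∀ k, 0 ≤ c k / Z := fun k => div_nonneg (hc k) hZ.le
  have hsum : ∑ k, ENNReal.ofReal (c k / Z) = 1 := by
    rw [← ENNReal.ofReal_sum_of_nonneg fun k _ => hw k, ← Finset.sum_div, div_self hZ.ne',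
      ENNReal.ofReal_one]
  let m : Measure ThetaCal := ∑ k, ENNReal.ofReal (c k / Z) • Measure.dirac (θ k)
  have hm : ∀ t : Set ThetaCal, MeasurableSet t → (∀ k, θ k ∈ t) → m t = 1 := fun t ht hθ => by
    simp [m, Measure.finsetSum_apply, Measure.dirac_apply' _ ht, hθ, hsum]
  refine ⟨⟨m, ⟨hm univ MeasurableSet.univ fun _ => mem_univ _⟩⟩, Finset.univ.image θ,
    hm _ (Finset.measurableSet _) fun k => by simp, fun u => ?_⟩
  change ∫ θ, betaStar θ.1.1 θ.1.2 u ∂m = _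
  have hi : ∀ k, Integrable (fun θ : ThetaCal => betaStar θ.1.1 θ.1.2 u)
      (ENNReal.ofReal (c k / Z) • Measure.dirac (θ k)) := fun k =>
    (integrable_dirac (by simp)).smul_measure ENNReal.ofReal_ne_top
  rw [integral_finsetSum_measure fun k _ => hi k, Finset.sum_div]
  refine Finset.sum_congr rfl fun k _ => ?_
  rw [integral_smul_measure, integral_dirac, ENNReal.toReal_ofReal (hw k), smul_eq_mul]
  ring

/-- A density on `(0, 1)` with finite entropy is approximated in Kullback–Leibler divergence by
finite beta mixtures. -/
lemma exists_finitely_supported_integral_mul_log_div_lt {g : ℝ → ℝ} (hg0 : ∀ u, 0 ≤ g u)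
    (hgm : Measurable g) (hgi : IntegrableOn g (Ioo 0 1)) (hg1 : ∫ u in Ioo 0 1, g u = 1)
    (hent : IntegrableOn (fun u => g u * Real.log (g u)) (Ioo 0 1)) {ε : ℝ} (hε : 0 < ε) :
    ∃ (G : ProbabilityMeasure ThetaCal) (s : Finset ThetaCal), (G : Measure ThetaCal) ↑s = 1 ∧
      ∫ u in Ioo 0 1, g u * Real.log (g u / betaMix G u) < ε := by
  set η := min (ε / 10) (1 / 2) with hη_def
  have hη : 0 < η := lt_min (by positivity) (by norm_num)
  have hηε : η ≤ ε / 10 := min_le_left _ _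
  have hη2 : η ≤ 1 / 2 := min_le_right _ _
  obtain ⟨φ, a, b, hφc, ha, ha1, hφ, hφ1, hφl⟩ := exists_continuous_approx hg0 hgm hgi hg1 hent hη
  have hτ : 0 < η * a := mul_pos hη ha
  have hτη : η * a ≤ η := mul_le_of_le_one_right hη.le ha1
  obtain ⟨n, c, θ, hc, happ⟩ := exists_bernstein_approx hφc (fun u => ha.le.trans (hφ u).1) hτ
  set B : ℝ → ℝ := fun u => ∑ k, c k * betaStar (θ k).1.1 (θ k).1.2 u with hB
  have hBi : ∀ k, IntegrableOn (fun u => c k * betaStar (θ k).1.1 (θ k).1.2 u) (Ioo 0 1) :=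
    fun k => (integral_betaStar (θ k)).1.const_mul _
  have hBint : IntegrableOn B (Ioo 0 1) := integrable_finsetSum _ fun k _ => hBi k
  have hBZ : ∫ u in Ioo 0 1, B u = ∑ k, c k := by
    rw [hB, integral_finsetSum _ fun k _ => hBi k]
    refine Finset.sum_congr rfl fun k _ => ?_
    rw [integral_const_mul, (integral_betaStar (θ k)).2, mul_one]
  have hBle : ∀ u ∈ Ioo (0 : ℝ) 1, B u ≤ φ u + η * a := fun u hu => by
    linarith [(abs_le.1 (happ u hu)).2]
  have hleB : ∀ u ∈ Ioo (0 : ℝ) 1, (1 - η) * φ u ≤ B u := fun u hu => by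
    have h1 := (abs_le.1 (happ u hu)).1
    have h2 := mul_le_mul_of_nonneg_left (hφ u).1 hη.le
    linarith
  have hvol : volume.real (Ioo (0 : ℝ) 1) = 1 := by simp
  have hφi : IntegrableOn φ (Ioo 0 1) := hφc.integrableOn_Icc.mono_set Ioo_subset_Icc_self
  have hZle : ∑ k, c k ≤ 1 + 2 * η := by
    have h : ∫ u in Ioo 0 1, B u ≤ ∫ u in Ioo 0 1, (φ u + η * a) :=
      setIntegral_mono_on hBint (hφi.add (integrable_const _)) measurableSet_Ioo hBle
    rw [hBZ, integral_add hφi (integrable_const _), setIntegral_const, hvol, one_smul] at h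
    linarith
  have hZpos : 0 < ∑ k, c k := by
    have h : ∫ _ in Ioo (0 : ℝ) 1, (1 - η) * a ≤ ∫ u in Ioo 0 1, B u :=
      setIntegral_mono_on (integrable_const _) hBint measurableSet_Ioo fun u hu =>
        (mul_le_mul_of_nonneg_left (hφ u).1 (by linarith)).trans (hleB u hu)
    rw [setIntegral_const, hvol, one_smul, hBZ] at h
    exact (mul_pos (by linarith) ha).trans_le h
  obtain ⟨G, s, hs, hG⟩ := exists_finitely_supported_betaMix hc hZpos θ
  refine ⟨G, s, hs, ?_⟩
  set Z := ∑ k, c k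
  have hGmem : ∀ u ∈ Ioo (0 : ℝ) 1, betaMix G u ∈ Icc ((1 - η) * a / Z) ((b + η * a) / Z) := by
    intro u hu
    rw [hG]
    refine ⟨div_le_div_of_nonneg_right ?_ hZpos.le, div_le_div_of_nonneg_right ?_ hZpos.le⟩
    · exact (mul_le_mul_of_nonneg_left (hφ u).1 (by linarith)).trans (hleB u hu)
    · exact (hBle u hu).trans (by linarith [(hφ u).2])
  have hlow : 0 < (1 - η) * a / Z := div_pos (mul_pos (by linarith) ha) hZpos
  have hGi := integrableOn_mul_log_of_mem_Icc hgi (measurable_betaMix G) hlow hGmem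
  have hφli := integrableOn_mul_log_of_mem_Icc hgi hφc.measurable ha fun u _ => hφ u
  have hlogη : -(2 * η) ≤ Real.log (1 - η) := by
    have h := Real.one_sub_inv_le_log_of_pos (show 0 < 1 - η by linarith)
    have h' : (1 - η)⁻¹ ≤ 1 + 2 * η := by
      rw [inv_le_iff_one_le_mul₀ (by linarith)]; nlinarith
    linarith
  have hlogZ : Real.log Z ≤ 2 * η := by linarith [Real.log_le_sub_one_of_pos hZpos]
  have hlogG : ∀ u ∈ Ioo (0 : ℝ) 1, Real.log (φ u) - 4 * η ≤ Real.log (betaMix G u) := by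
    intro u hu
    have hφp := ha.trans_le (hφ u).1
    have hp : 0 < (1 - η) * φ u := mul_pos (by linarith) hφp
    have h := Real.log_le_log hp (hleB u hu)
    rw [Real.log_mul (by linarith) hφp.ne'] at h
    rw [hG, Real.log_div (hp.trans_le (hleB u hu)).ne' hZpos.ne']
    linarith
  have hmain : (∫ u in Ioo 0 1, g u * Real.log (φ u)) - 4 * η ≤
      ∫ u in Ioo 0 1, g u * Real.log (betaMix G u) := by
    have h : ∫ u in Ioo 0 1, (g u * Real.log (φ u) - g u * (4 * η)) ≤
        ∫ u in Ioo 0 1, g u * Real.log (betaMix G u) :=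
      setIntegral_mono_on (hφli.sub (hgi.mul_const _)) hGi measurableSet_Ioo fun u hu => by
        rw [← mul_sub]; exact mul_le_mul_of_nonneg_left (hlogG u hu) (hg0 u)
    rwa [integral_sub hφli (hgi.mul_const _), integral_mul_const, hg1, one_mul] at h
  rw [setIntegral_congr_fun measurableSet_Ioo fun u hu =>
    mul_log_div (a := g u) (hlow.trans_le (hGmem u hu).1).ne', integral_sub hent hGi]
  linarith

/-! ### Transfer through the quantile function -/

/-- The quantile function of an absolutely continuous distribution pushes the uniform distribution
to it and is a right inverse of the cdf. -/
lemma exists_quantile {h : ℝ → ℝ} (h0 : ∀ y, 0 ≤ h y) (hi : Integrable h) (h1 : ∫ y, h y = 1) :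
    ∃ Q : ℝ → ℝ, Measurable Q ∧ (∀ u ∈ Ioo (0 : ℝ) 1, cdfOf h (Q u) = u) ∧
      Measure.map Q (volume.restrict (Ioo 0 1)) =
        volume.withDensity fun y => ENNReal.ofReal (h y) := by
  set P : Measure ℝ := volume.withDensity fun y => ENNReal.ofReal (h y) with hP
  have hPset : ∀ s, MeasurableSet s → P s = ENNReal.ofReal (∫ y in s, h y) := fun s hs => by
    rw [hP, withDensity_apply _ hs,
      ofReal_integral_eq_lintegral_ofReal hi.integrableOn (ae_of_all _ h0)]
  have : IsProbabilityMeasure P := ⟨by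
    rw [hPset _ MeasurableSet.univ, setIntegral_univ, h1, ENNReal.ofReal_one]⟩
  have hcdf : ∀ y, ProbabilityTheory.cdf P y = cdfOf h y := fun y => by
    rw [ProbabilityTheory.cdf_eq_real, Measure.real, hPset _ measurableSet_Iic,
      ENNReal.toReal_ofReal (integral_nonneg h0), cdfOf]
  have hmono : Monotone (cdfOf h) := by
    have := ProbabilityTheory.monotone_cdf P
    rwa [funext hcdf] at this
  have hbot : Tendsto (cdfOf h) atBot (𝓝 0) := by
    have := ProbabilityTheory.tendsto_cdf_atBot P
    rwa [funext hcdf] at this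
  have htop : Tendsto (cdfOf h) atTop (𝓝 1) := by
    have := ProbabilityTheory.tendsto_cdf_atTop P
    rwa [funext hcdf] at this
  have hcont : Continuous (cdfOf h) := by
    have h2 : cdfOf h = fun y => (∫ z in (0 : ℝ)..y, h z) + ∫ z in Iic 0, h z := by
      funext y
      rw [cdfOf, ← intervalIntegral.integral_Iic_sub_Iic hi.integrableOn hi.integrableOn]
      ring
    rw [h2]
    exact (intervalIntegral.continuous_primitive (fun _ _ => hi.intervalIntegrable) 0).add
      continuous_const
  have hne : ∀ u ∈ Ioo (0 : ℝ) 1, {y | u ≤ cdfOf h y}.Nonempty := fun u hu =>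
    ((htop.eventually_const_lt hu.2).mono fun _ => le_of_lt).exists
  have hbdd : ∀ u ∈ Ioo (0 : ℝ) 1, BddBelow {y | u ≤ cdfOf h y} := fun u hu => by
    obtain ⟨a, ha⟩ := (hbot.eventually_lt_const hu.1).exists
    exact ⟨a, fun y hy => le_of_not_gt fun hya => (hy.trans (hmono hya.le)).not_gt ha⟩
  classical
  let Q : ℝ → ℝ := fun u => if u ∈ Ioo (0 : ℝ) 1 then sInf {y | u ≤ cdfOf h y} else 0
  have hQmem : ∀ u ∈ Ioo (0 : ℝ) 1, u ≤ cdfOf h (Q u) := fun u hu => by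
    simp only [Q, if_pos hu]
    exact (isClosed_le continuous_const hcont).csInf_mem (hne u hu) (hbdd u hu)
  have hQle : ∀ u ∈ Ioo (0 : ℝ) 1, ∀ y, Q u ≤ y ↔ u ≤ cdfOf h y := fun u hu y => by
    refine ⟨fun hy => (hQmem u hu).trans (hmono hy), fun hy => ?_⟩
    simp only [Q, if_pos hu]
    exact csInf_le (hbdd u hu) hy
  have hpre : ∀ y, Q ⁻¹' Iic y ∩ Ioo 0 1 = Iic (cdfOf h y) ∩ Ioo 0 1 := fun y => by
    ext u
    exact and_congr_left fun hu => hQle u hu y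
  have hQm : Measurable Q := by
    refine measurable_of_Iic fun y => ?_
    have h2 : Q ⁻¹' Iic y = (Iic (cdfOf h y) ∩ Ioo 0 1) ∪ ({_u : ℝ | 0 ≤ y} ∩ (Ioo 0 1)ᶜ) := by
      rw [← hpre, ← inter_union_compl (Q ⁻¹' Iic y) (Ioo 0 1)]
      congr 1
      · ext u; simp +contextual
      · ext u
        refine and_congr_left fun hu => ?_
        have : Q u = 0 := if_neg hu
        simp [this]
    rw [h2]
    exact (measurableSet_Iic.inter measurableSet_Ioo).union
      ((MeasurableSet.const _).inter measurableSet_Ioo.compl)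
  refine ⟨Q, hQm, fun u hu => le_antisymm ?_ (hQmem u hu), ?_⟩
  · obtain ⟨y, hy⟩ : ∃ y, cdfOf h y = u := by
      obtain ⟨a, ha⟩ := (hbot.eventually_lt_const hu.1).exists
      obtain ⟨b, hb⟩ := (htop.eventually_const_lt hu.2).exists
      exact mem_range_of_exists_le_of_exists_ge hcont ⟨a, ha.le⟩ ⟨b, hb.le⟩
    exact (hmono ((hQle u hu y).2 hy.ge)).trans hy.le
  · refine (Measure.ext_of_Iic _ _ fun y => ?_).symm
    have hy0 : 0 ≤ cdfOf h y := integral_nonneg h0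
    have hy1 : cdfOf h y ≤ 1 := hmono.ge_of_tendsto htop y
    rw [Measure.map_apply hQm measurableSet_Iic, Measure.restrict_apply (hQm measurableSet_Iic),
      hpre, hPset _ measurableSet_Iic]
    have h3 : (Iic (cdfOf h y) ∩ Ioo 0 1 : Set ℝ) =ᵐ[volume] Ioc 0 (cdfOf h y) := by
      have h4 : (Iic (cdfOf h y) ∩ Ioc 0 1 : Set ℝ) = Ioc 0 (cdfOf h y) := by
        ext u; simp only [mem_inter_iff, mem_Iic, mem_Ioc]
        exact ⟨fun hu => ⟨hu.2.1, hu.1⟩, fun hu => ⟨hu.2, hu.1, hu.2.trans hy1⟩⟩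
      rw [← h4]
      exact (ae_eq_refl _).inter Ioo_ae_eq_Ioc
    rw [measure_congr h3, Real.volume_Ioc, sub_zero, cdfOf]

/-- Change of variables `u = H y` for integrals against a density. -/
lemma integral_mul_density_iff {h Q : ℝ → ℝ} (h0 : ∀ y, 0 ≤ h y) (hm : Measurable h)
    (hQm : Measurable Q) (hQ : Measure.map Q (volume.restrict (Ioo 0 1)) =
      volume.withDensity fun y => ENNReal.ofReal (h y)) {F : ℝ → ℝ} (hF : Measurable F) :
    (Integrable (fun y => h y * F y) ↔ IntegrableOn (fun u => F (Q u)) (Ioo 0 1)) ∧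
      ∫ y, h y * F y = ∫ u in Ioo 0 1, F (Q u) := by
  have htop : ∀ᵐ y : ℝ, ENNReal.ofReal (h y) < ⊤ := ae_of_all _ fun _ => ENNReal.ofReal_lt_top
  constructor
  · have h1 := integrable_withDensity_iff_integrable_smul' hm.ennreal_ofReal htop (g := F)
    simp only [ENNReal.toReal_ofReal (h0 _), smul_eq_mul] at h1
    rw [← h1, ← hQ, integrable_map_measure hF.aestronglyMeasurable hQm.aemeasurable]
    rfl
  · have h1 := integral_withDensity_eq_integral_toReal_smul hm.ennreal_ofReal htop F
    simp only [ENNReal.toReal_ofReal (h0 _), smul_eq_mul] at h1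
    rw [← h1, ← hQ, integral_map hQm.aemeasurable hF.aestronglyMeasurable]

end BetaCalibration

/-- Theorem S.2 (Kullback–Leibler property for calibration with fixed pooling weights). -/
theorem beta_calibration_fixed_weights_KL_property
    (M : ℕ) (Y : Set ℝ) (f : Fin M → ℝ → ℝ)
    -- f₁,…,f_M are probability densities on Y with cdfs F_m = cdfOf (f m)
    (hf_nonneg : ∀ m y, 0 ≤ f m y)
    (hf_supp : ∀ m, ∀ y ∉ Y, f m y = 0)
    (hf_meas : ∀ m, Measurable (f m))
    (hf_int : ∀ m, ∫ y, f m y = 1)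
    -- ω₀ ∈ Δ_M fixed
    (ω₀ : Fin M → ℝ) (hω₀ : ω₀ ∈ stdSimplex ℝ (Fin M))
    -- h(·|ω₀) continuous and bounded below away from 0 on compacts of Y
    (hcont : ContinuousOn (fun y => ∑ m, ω₀ m * f m y) Y)
    (hinf : ∀ C : Set ℝ, C ⊆ Y → IsCompact C →
      ∃ c > 0, ∀ y ∈ C, c ≤ ∑ m, ω₀ m * f m y)
    -- the true density f₀ : continuous density on Y
    (f₀ : ℝ → ℝ)
    (hf₀_nonneg : ∀ y, 0 ≤ f₀ y) (hf₀_supp : ∀ y ∉ Y, f₀ y = 0)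
    (hf₀_meas : Measurable f₀) (hf₀_int : ∫ y, f₀ y = 1)
    (hf₀_cont : ContinuousOn f₀ Y)
    -- ∫ [|log H(y|ω₀)| + |log(1 − H(y|ω₀))|] f₀(y) dy < ∞
    (hlog : Integrable (fun y =>
      (|Real.log (∑ m, ω₀ m * cdfOf (f m) y)| +
        |Real.log (1 - ∑ m, ω₀ m * cdfOf (f m) y)|) * f₀ y))
    -- KL(f₀, h(·|ω₀)) < ∞
    (hKL : Integrable (fun y => f₀ y * Real.log (f₀ y / ∑ m, ω₀ m * f m y)))
    -- the prior Π on M(Θ) whose weak support contains all finitely supported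
    -- probability measures on Θ
    (Pr : Measure (ProbabilityMeasure ThetaCal))
    (hPr : IsProbabilityMeasure Pr)
    (hsupp : ∀ G : ProbabilityMeasure ThetaCal,
      (∃ s : Finset ThetaCal, (G : Measure ThetaCal) ↑s = 1) →
      G ∈ measureSupport Pr) :
    ∀ ε > 0, 0 < Pr {G : ProbabilityMeasure ThetaCal |
      Integrable (fun y => f₀ y * Real.log (f₀ y / calMixDensity M f ω₀ G y)) ∧
      ∫ y, f₀ y * Real.log (f₀ y / calMixDensity M f ω₀ G y) ≤ ε} := by
  intro ε hε
  set h : ℝ → ℝ := fun y => ∑ m, ω₀ m * f m y with hh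
  have hfi : ∀ m, Integrable (f m) := fun m =>
    Integrable.of_integral_ne_zero (by rw [hf_int m]; exact one_ne_zero)
  have hH : ∀ y, ∑ m, ω₀ m * cdfOf (f m) y = cdfOf h y := fun y => by
    simp only [cdfOf, hh]
    rw [integral_finsetSum _ fun m _ => ((hfi m).integrableOn).const_mul _]
    simp only [integral_const_mul]
  have h0 : ∀ y, 0 ≤ h y := fun y =>
    Finset.sum_nonneg fun m _ => mul_nonneg (hω₀.1 m) (hf_nonneg m y)
  have hm : Measurable h := Finset.measurable_fun_sum _ fun m _ => (hf_meas m).const_mul _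
  have hi : Integrable h := integrable_finsetSum _ fun m _ => (hfi m).const_mul _
  have h1 : ∫ y, h y = 1 := by
    rw [hh, integral_finsetSum _ fun m _ => (hfi m).const_mul _]
    simp only [integral_const_mul, hf_int, mul_one]
    exact hω₀.2
  have hpos : ∀ y ∈ Y, 0 < h y := fun y hy => by
    obtain ⟨c, hc, hle⟩ := hinf {y} (singleton_subset_iff.2 hy) isCompact_singleton
    exact hc.trans_le (hle y rfl)
  have hout : ∀ y ∉ Y, h y = 0 := fun y hy => by simp [hh, hf_supp _ y hy]
  obtain ⟨Q, hQm, hQ, hQmap⟩ := BetaCalibration.exists_quantile h0 hi h1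
  -- the density ratio, so that `f₀ = h * r`
  set r : ℝ → ℝ := fun y => f₀ y / h y with hr
  have hrm : Measurable r := hf₀_meas.div hm
  have hr0 : ∀ y, 0 ≤ r y := fun y => div_nonneg (hf₀_nonneg y) (h0 y)
  have hhr : ∀ y, h y * r y = f₀ y := fun y => by
    by_cases hy : y ∈ Y
    · exact mul_div_cancel₀ _ (hpos y hy).ne'
    · rw [hout y hy, hf₀_supp y hy, zero_mul]
  have transfer : ∀ {F : ℝ → ℝ}, Measurable F →
      (Integrable (fun y => h y * F y) ↔ IntegrableOn (fun u => F (Q u)) (Ioo 0 1)) ∧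
      ∫ y, h y * F y = ∫ u in Ioo 0 1, F (Q u) := fun hF =>
    BetaCalibration.integral_mul_density_iff h0 hm hQm hQmap hF
  have hHm : Measurable (cdfOf h) := by
    have : Monotone (cdfOf h) := fun a b hab =>
      setIntegral_mono_set hi.integrableOn (Filter.Eventually.of_forall h0)
        (Iic_subset_Iic.2 hab).eventuallyLE
    exact this.measurable
  have hf₀i : Integrable f₀ :=
    Integrable.of_integral_ne_zero (by rw [hf₀_int]; exact one_ne_zero)
  have hg1 : ∫ u in Ioo 0 1, r (Q u) = 1 := by
    rw [← (transfer hrm).2, ← hf₀_int]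
    simp only [hhr]
  have hgi : IntegrableOn (fun u => r (Q u)) (Ioo 0 1) := by
    rw [← (transfer hrm).1]
    simpa only [hhr] using hf₀i
  have hent : IntegrableOn (fun u => r (Q u) * Real.log (r (Q u))) (Ioo 0 1) := by
    refine (transfer (F := fun y => r y * Real.log (r y)) (hrm.mul hrm.log)).1.1 ?_
    simpa only [← mul_assoc, hhr] using hKL
  have hlogS : IntegrableOn (fun u => BetaCalibration.logScale u * r (Q u)) (Ioo 0 1) := by
    have hSm : Measurable fun y => (|Real.log (cdfOf h y)| + |Real.log (1 - cdfOf h y)|) * r y :=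
      ((continuous_abs.measurable.comp hHm.log).add
        (continuous_abs.measurable.comp (measurable_const.sub hHm).log)).mul hrm
    have h2 : IntegrableOn (fun u => (|Real.log (cdfOf h (Q u))| +
        |Real.log (1 - cdfOf h (Q u))|) * r (Q u)) (Ioo 0 1) := by
      rw [← (transfer hSm).1]
      refine hlog.congr (Filter.Eventually.of_forall fun y => ?_)
      simp only [hH, ← hhr y]
      ring
    refine (hgi.add h2).congr_fun (fun u hu => ?_) measurableSet_Ioo
    simp only [Pi.add_apply, hQ u hu, BetaCalibration.logScale]
    ring
  have hgm : Measurable fun u => r (Q u) := hrm.comp hQm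
  obtain ⟨G₀, s, hs, hlt⟩ :=
    BetaCalibration.exists_finitely_supported_integral_mul_log_div_lt (fun u => hr0 (Q u)) hgm hgi
      hg1 hent hε
  obtain ⟨U, hUo, hGU, hU⟩ :=
    BetaCalibration.exists_isOpen_integral_mul_log_div_betaMix_le (fun u => hr0 (Q u)) hgm hgi
      hent hlogS hs hlt
  refine (hsupp G₀ ⟨s, hs⟩ U hUo hGU).trans_le (measure_mono fun G hG => ?_)
  have hmix : ∀ y, calMixDensity M f ω₀ G y = BetaCalibration.betaMix G (cdfOf h y) * h y :=
    fun y => by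
      simp only [calMixDensity, calKernel, hH, BetaCalibration.betaMix]
      exact integral_mul_const _ _
  have hFm : Measurable fun y =>
      r y * Real.log (r y / BetaCalibration.betaMix G (cdfOf h y)) :=
    hrm.mul (hrm.div ((BetaCalibration.measurable_betaMix G).comp hHm)).log
  have hF : (fun y => f₀ y * Real.log (f₀ y / calMixDensity M f ω₀ G y)) = fun y =>
      h y * (r y * Real.log (r y / BetaCalibration.betaMix G (cdfOf h y))) := by
    funext y
    rw [← mul_assoc, hhr, hmix, hr, div_div, mul_comm (h y)]
  have hcongr : EqOn (fun u => r (Q u) * Real.log (r (Q u) / BetaCalibration.betaMix G u))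
      (fun u => r (Q u) * Real.log (r (Q u) / BetaCalibration.betaMix G (cdfOf h (Q u))))
      (Ioo 0 1) := fun u hu => by simp only [hQ u hu]
  rw [mem_ofPred_eq, hF, (transfer hFm).1, (transfer hFm).2,
    ← setIntegral_congr_fun measurableSet_Ioo hcongr]
  exact ⟨(hU G hG).1.congr_fun hcongr measurableSet_Ioo, (hU G hG).2⟩
end

section
/- Let μ₀ ∈ (0,1), ν₀ > 0, w₀ ∈ (0,1), let P₀ be a probability measure on (0,1) × (0,∞), and set u₀(x) = w₀ b*_{μ₀,ν₀}(x) + (1−w₀) ∫ b*_{μ,ν}(x) P₀(dμ dν). Suppose there exist ζ > 0 and 0 < η < min(μ₀, 1−μ₀, ν₀, w₀) such that ∫₀¹ u₀(x)^{ζ+1} / (x^{ζA}(1−x)^{ζB}) dx < +∞, where A = (μ₀+η)(ν₀+η)−1 and B = (1−μ₀+η)(ν₀+η)−1. Then for every ε > 0 there exist η'' ∈ (0,η] and η' > 0 such that: for every w₁, μ₁, ν₁ with |w₁−w₀| ≤ η'', |μ₁−μ₀| ≤ η'', |ν₁−ν₀| ≤ η'', and every probability measure G₁ on (0,1) × (0,∞)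 with ∫₀¹ |u_{G₁}(x) − u_{P₀}(x)| dx ≤ η', the mixture density u_G(x) = w₁ b*_{μ₁,ν₁}(x) + (1−w₁) u_{G₁}(x) satisfies KL(u₀, u_G) ≤ ε. -/
open MeasureTheory Set

/-- Beta mixture `u_Q(x) = ∫ b*_{μ,ν}(x) Q(dμ dν)`. -/
noncomputable def betaMix (Q : Measure (ℝ × ℝ)) (x : ℝ) : ℝ :=
  ∫ p, betaStar p.1 p.2 x ∂Q

open Filter Topology

/-- The normalizing constant of the reparametrized beta density. -/
noncomputable def betaNorm (p : ℝ × ℝ) : ℝ :=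
  Real.Gamma p.2 / (Real.Gamma (p.1 * p.2) * Real.Gamma ((1 - p.1) * p.2))

lemma betaStar_eq (μ ν x : ℝ) :
    betaStar μ ν x = betaNorm (μ, ν) * x ^ (μ * ν - 1) * (1 - x) ^ ((1 - μ) * ν - 1) := rfl

lemma betaNorm_pos {p : ℝ × ℝ} (hp : p ∈ Ioo (0:ℝ) 1 ×ˢ Ioi (0:ℝ)) : 0 < betaNorm p := by
  obtain ⟨⟨h0, h1⟩, h2⟩ := hp
  have h2 : 0 < p.2 := h2
  exact div_pos (Real.Gamma_pos_of_pos h2) (mul_pos (Real.Gamma_pos_of_pos (mul_pos h0 h2))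
    (Real.Gamma_pos_of_pos (mul_pos (sub_pos.2 h1) h2)))

lemma continuousAt_betaNorm {p : ℝ × ℝ} (hp : p ∈ Ioo (0:ℝ) 1 ×ˢ Ioi (0:ℝ)) :
    ContinuousAt betaNorm p := by
  obtain ⟨⟨h0, h1⟩, h2⟩ := hp
  have h2 : 0 < p.2 := h2
  have hΓ {s : ℝ} (hs : 0 < s) : ContinuousAt Real.Gamma s :=
    (Real.differentiableOn_Gamma_Ioi.differentiableAt (Ioi_mem_nhds hs)).continuousAt
  have ha : 0 < p.1 * p.2 := mul_pos h0 h2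
  have hb : 0 < (1 - p.1) * p.2 := mul_pos (sub_pos.2 h1) h2
  have c0 : ContinuousAt (fun q : ℝ × ℝ => Real.Gamma q.2) p :=
    ContinuousAt.comp (f := fun q : ℝ × ℝ => q.2) (hΓ h2) (by fun_prop)
  have c1 : ContinuousAt (fun q : ℝ × ℝ => Real.Gamma (q.1 * q.2)) p :=
    ContinuousAt.comp (f := fun q : ℝ × ℝ => q.1 * q.2) (hΓ ha) (by fun_prop)
  have c2 : ContinuousAt (fun q : ℝ × ℝ => Real.Gamma ((1 - q.1) * q.2)) p :=
    ContinuousAt.comp (f := fun q : ℝ × ℝ => (1 - q.1) * q.2) (hΓ hb) (by fun_prop)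
  exact c0.div (c1.mul c2)
    (mul_pos (Real.Gamma_pos_of_pos ha) (Real.Gamma_pos_of_pos hb)).ne'

lemma betaStar_pos {μ ν x : ℝ} (hp : (μ, ν) ∈ Ioo (0:ℝ) 1 ×ˢ Ioi (0:ℝ))
    (hx : x ∈ Ioo (0:ℝ) 1) : 0 < betaStar μ ν x :=
  mul_pos (mul_pos (betaNorm_pos hp) (Real.rpow_pos_of_pos hx.1 _))
    (Real.rpow_pos_of_pos (sub_pos.2 hx.2) _)

lemma continuousAt_betaStar {x : ℝ} {p : ℝ × ℝ} (hx : x ∈ Ioo (0:ℝ) 1)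
    (hp : p ∈ Ioo (0:ℝ) 1 ×ˢ Ioi (0:ℝ)) :
    ContinuousAt (fun z : ℝ × (ℝ × ℝ) => betaStar z.2.1 z.2.2 z.1) (x, p) := by
  have h0 : ContinuousAt (fun z : ℝ × (ℝ × ℝ) => betaNorm z.2) (x, p) :=
    ContinuousAt.comp (f := fun z : ℝ × (ℝ × ℝ) => z.2) (continuousAt_betaNorm hp) (by fun_prop)
  have h1 : ContinuousAt (fun z : ℝ × (ℝ × ℝ) => z.1 ^ (z.2.1 * z.2.2 - 1)) (x, p) :=
    ContinuousAt.rpow (by fun_prop) (by fun_prop) (Or.inl hx.1.ne')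
  have h2 : ContinuousAt
      (fun z : ℝ × (ℝ × ℝ) => (1 - z.1) ^ ((1 - z.2.1) * z.2.2 - 1)) (x, p) :=
    ContinuousAt.rpow (by fun_prop) (by fun_prop) (Or.inl (sub_pos.2 hx.2).ne')
  exact (h0.mul h1).mul h2

lemma integral_betaStar {μ ν : ℝ} (hp : (μ, ν) ∈ Ioo (0:ℝ) 1 ×ˢ Ioi (0:ℝ)) :
    ∫ x in Ioo (0:ℝ) 1, betaStar μ ν x = 1 := by
  obtain ⟨⟨h0, h1⟩, h2⟩ := hp
  have h2 : 0 < ν := h2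
  have ha : 0 < μ * ν := mul_pos h0 h2
  have hb : 0 < (1 - μ) * ν := mul_pos (sub_pos.2 h1) h2
  have heq (x : ℝ) : betaStar μ ν x = 1 / ProbabilityTheory.beta (μ * ν) ((1 - μ) * ν) *
      x ^ (μ * ν - 1) * (1 - x) ^ ((1 - μ) * ν - 1) := by
    rw [betaStar, ProbabilityTheory.beta, one_div_div, show μ * ν + (1 - μ) * ν = ν by ring]
  rw [integral_eq_lintegral_of_nonneg_ae]
  · simp_rw [heq]
    rw [← ProbabilityTheory.lintegral_betaPDF, ProbabilityTheory.lintegral_betaPDF_eq_one ha hb,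
      ENNReal.toReal_one]
  · exact ae_restrict_of_forall_mem measurableSet_Ioo fun x hx =>
      (betaStar_pos ⟨⟨h0, h1⟩, h2⟩ hx).le
  · unfold betaStar
    exact Measurable.aestronglyMeasurable (by fun_prop)

lemma integrableOn_betaStar {μ ν : ℝ} (hp : (μ, ν) ∈ Ioo (0:ℝ) 1 ×ˢ Ioi (0:ℝ)) :
    IntegrableOn (betaStar μ ν) (Ioo (0:ℝ) 1) :=
  not_imp_comm.1 integral_undef (by rw [integral_betaStar hp]; exact one_ne_zero)

section Mixture

variable {Q : Measure (ℝ × ℝ)}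

lemma ae_mem_of_prob_eq_one [IsProbabilityMeasure Q]
    (hQ : Q (Ioo (0:ℝ) 1 ×ˢ Ioi (0:ℝ)) = 1) : ∀ᵐ p ∂Q, p ∈ Ioo (0:ℝ) 1 ×ˢ Ioi (0:ℝ) :=
  mem_ae_iff.2 ((prob_compl_eq_zero_iff (measurableSet_Ioo.prod measurableSet_Ioi)).2 hQ)

lemma integrable_betaStar_prod [IsProbabilityMeasure Q]
    (hQ : Q (Ioo (0:ℝ) 1 ×ˢ Ioi (0:ℝ)) = 1) :
    Integrable (fun z : ℝ × (ℝ × ℝ) => betaStar z.2.1 z.2.2 z.1)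
      ((volume.restrict (Ioo (0:ℝ) 1)).prod Q) := by
  have hae := ae_mem_of_prob_eq_one hQ
  have hD : MeasurableSet (Ioo (0:ℝ) 1 ×ˢ Ioi (0:ℝ)) := measurableSet_Ioo.prod measurableSet_Ioi
  have hmeas : AEStronglyMeasurable (fun z : ℝ × (ℝ × ℝ) => betaStar z.2.1 z.2.2 z.1)
      ((volume.restrict (Ioo (0:ℝ) 1)).prod Q) := by
    rw [← Measure.restrict_eq_self_of_ae_mem hae, Measure.prod_restrict]
    exact ContinuousOn.aestronglyMeasurable
      (fun z hz => (continuousAt_betaStar hz.1 hz.2).continuousWithinAt)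
      (measurableSet_Ioo.prod hD)
  rw [integrable_prod_iff' hmeas]
  refine ⟨hae.mono fun p hp => integrableOn_betaStar hp, ?_⟩
  refine (integrable_const (1:ℝ)).congr (hae.mono fun p hp => ?_)
  refine (integral_betaStar hp).symm.trans ?_
  exact setIntegral_congr_fun measurableSet_Ioo fun x hx =>
    (Real.norm_of_nonneg (betaStar_pos hp hx).le).symm

lemma integrableOn_betaMix [IsProbabilityMeasure Q]
    (hQ : Q (Ioo (0:ℝ) 1 ×ˢ Ioi (0:ℝ)) = 1) : IntegrableOn (betaMix Q) (Ioo (0:ℝ) 1) :=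
  (integrable_betaStar_prod hQ).integral_prod_left

lemma integral_betaMix [IsProbabilityMeasure Q]
    (hQ : Q (Ioo (0:ℝ) 1 ×ˢ Ioi (0:ℝ)) = 1) : ∫ x in Ioo (0:ℝ) 1, betaMix Q x = 1 := by
  unfold betaMix
  rw [integral_integral_swap (f := fun x (p : ℝ × ℝ) => betaStar p.1 p.2 x)
    (integrable_betaStar_prod hQ),
    integral_congr_ae ((ae_mem_of_prob_eq_one hQ).mono fun p hp => integral_betaStar hp)]
  simp

lemma betaMix_nonneg [IsProbabilityMeasure Q]
    (hQ : Q (Ioo (0:ℝ) 1 ×ˢ Ioi (0:ℝ)) = 1) {x : ℝ} (hx : x ∈ Ioo (0:ℝ) 1) :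
    0 ≤ betaMix Q x :=
  integral_nonneg_of_ae ((ae_mem_of_prob_eq_one hQ).mono fun _ hp => (betaStar_pos hp hx).le)

end Mixture

/-- The reparametrized beta densities depend continuously in `L¹` on their parameters. -/
lemma tendsto_integral_abs_betaStar_sub {p₀ : ℝ × ℝ} (hp₀ : p₀ ∈ Ioo (0:ℝ) 1 ×ˢ Ioi (0:ℝ)) :
    Tendsto (fun p : ℝ × ℝ => ∫ x in Ioo (0:ℝ) 1, |betaStar p₀.1 p₀.2 x - betaStar p.1 p.2 x|)
      (𝓝 p₀) (𝓝 0) := by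
  obtain ⟨⟨h0, h1⟩, h2⟩ := id hp₀
  have h2 : 0 < p₀.2 := h2
  have hhalf : (p₀.1, p₀.2 / 2) ∈ Ioo (0:ℝ) 1 ×ˢ Ioi (0:ℝ) := ⟨⟨h0, h1⟩, half_pos h2⟩
  have hN := betaNorm_pos hhalf
  have ha : 0 < p₀.1 * p₀.2 := mul_pos h0 h2
  have hb : 0 < (1 - p₀.1) * p₀.2 := mul_pos (sub_pos.2 h1) h2
  set C : ℝ := (betaNorm p₀ + 1) / betaNorm (p₀.1, p₀.2 / 2) with hC
  have hD : ∀ᶠ p in 𝓝 p₀, p ∈ Ioo (0:ℝ) 1 ×ˢ Ioi (0:ℝ) :=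
    (isOpen_Ioo.prod isOpen_Ioi).mem_nhds hp₀
  have hle : ∀ᶠ p in 𝓝 p₀, betaNorm p < betaNorm p₀ + 1 :=
    (continuousAt_betaNorm hp₀).eventually (gt_mem_nhds (lt_add_one _))
  have hea : ∀ᶠ p : ℝ × ℝ in 𝓝 p₀, p₀.1 * (p₀.2 / 2) < p.1 * p.2 :=
    (show ContinuousAt (fun p : ℝ × ℝ => p.1 * p.2) p₀ by fun_prop).tendsto.eventually
      (lt_mem_nhds (by linarith))
  have heb : ∀ᶠ p : ℝ × ℝ in 𝓝 p₀, (1 - p₀.1) * (p₀.2 / 2) < (1 - p.1) * p.2 :=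
    (show ContinuousAt (fun p : ℝ × ℝ => (1 - p.1) * p.2) p₀ by fun_prop).tendsto.eventually
      (lt_mem_nhds (by linarith))
  have key := tendsto_integral_filter_of_dominated_convergence
    (μ := volume.restrict (Ioo (0:ℝ) 1)) (l := 𝓝 p₀)
    (F := fun (p : ℝ × ℝ) x => |betaStar p₀.1 p₀.2 x - betaStar p.1 p.2 x|) (f := fun _ => (0:ℝ))
    (fun x => betaStar p₀.1 p₀.2 x + C * betaStar p₀.1 (p₀.2 / 2) x) ?_ ?_ ?_ ?_
  · simpa using key
  · refine Eventually.of_forall fun p => Measurable.aestronglyMeasurable ?_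
    unfold betaStar
    fun_prop
  · filter_upwards [hD, hle, hea, heb] with p hp h3 h4 h5
    refine ae_restrict_of_forall_mem measurableSet_Ioo fun x hx => ?_
    have hx' : 0 < 1 - x := sub_pos.2 hx.2
    rw [Real.norm_eq_abs, abs_abs]
    have e0 := betaStar_pos (μ := p₀.1) (ν := p₀.2) hp₀ hx
    have e1 := betaStar_pos (μ := p.1) (ν := p.2) hp hx
    have e2 : betaStar p.1 p.2 x ≤ C * betaStar p₀.1 (p₀.2 / 2) x := by
      have e3 : x ^ (p.1 * p.2 - 1) ≤ x ^ (p₀.1 * (p₀.2 / 2) - 1) :=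
        Real.rpow_le_rpow_of_exponent_ge hx.1 hx.2.le (by linarith)
      have e4 : (1 - x) ^ ((1 - p.1) * p.2 - 1) ≤ (1 - x) ^ ((1 - p₀.1) * (p₀.2 / 2) - 1) :=
        Real.rpow_le_rpow_of_exponent_ge hx' (by linarith [hx.1]) (by linarith)
      have e5 : C * betaStar p₀.1 (p₀.2 / 2) x = (betaNorm p₀ + 1) *
          x ^ (p₀.1 * (p₀.2 / 2) - 1) * (1 - x) ^ ((1 - p₀.1) * (p₀.2 / 2) - 1) := by
        rw [hC, betaStar_eq]
        field_simp
      have e6 := betaNorm_pos hp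
      rw [e5, betaStar_eq]
      have e7 : betaNorm (p.1, p.2) ≤ betaNorm p₀ + 1 := h3.le
      have e8 := betaNorm_pos hp₀
      have hx0 := hx.1
      gcongr
    rw [abs_le]
    constructor <;> linarith
  · exact (integrableOn_betaStar hp₀).add ((integrableOn_betaStar hhalf).const_mul C)
  · refine ae_restrict_of_forall_mem measurableSet_Ioo fun x hx => ?_
    have hc : ContinuousAt (fun p : ℝ × ℝ => betaStar p.1 p.2 x) p₀ :=
      ContinuousAt.comp (f := fun p : ℝ × ℝ => (x, p)) (continuousAt_betaStar hx hp₀)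
        (by fun_prop)
    have := (tendsto_const_nhds (x := betaStar p₀.1 p₀.2 x)).sub hc.tendsto
    simpa using this.abs

/-- A pointwise bound on the Kullback–Leibler integrand by the `L¹` integrand and a moment of any
upper bound for the likelihood ratio. -/
lemma mul_log_div_le_s3 {a b R M s : ℝ} (ha : 0 < a) (hb : 0 < b) (hM : 0 < M) (hs : 0 < s)
    (hR : a / b ≤ R) :
    a * Real.log (a / b) ≤ M * |a - b| + 2 / s * M ^ (-(s / 2)) * (a * R ^ s) := by
  have ht : 0 < a / b := div_pos ha hb
  have hR0 : 0 < R := ht.trans_le hR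
  have hRs := Real.rpow_pos_of_pos hR0 s
  have hMs := Real.rpow_pos_of_pos hM (-(s / 2))
  rcases le_total (a / b) M with h | h
  · have h1 : a * Real.log (a / b) ≤ a * (a / b - 1) :=
      mul_le_mul_of_nonneg_left (Real.log_le_sub_one_of_pos ht) ha.le
    have h2 : a * (a / b - 1) = a / b * (a - b) := by field_simp
    have h3 : a / b * (a - b) ≤ a / b * |a - b| :=
      mul_le_mul_of_nonneg_left (le_abs_self _) ht.le
    have h4 : a / b * |a - b| ≤ M * |a - b| := mul_le_mul_of_nonneg_right h (abs_nonneg _)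
    have h5 : 0 ≤ 2 / s * M ^ (-(s / 2)) * (a * R ^ s) := by positivity
    linarith
  · have h1 : Real.log (a / b) ≤ R ^ (s / 2) / (s / 2) :=
      (Real.log_le_log ht hR).trans (Real.log_le_rpow_div hR0.le (half_pos hs))
    have h2 : R ^ (s / 2) ≤ M ^ (-(s / 2)) * R ^ s := by
      have e1 : R ^ s = R ^ (s / 2) * R ^ (s / 2) := by
        rw [← Real.rpow_add hR0, add_halves]
      have e2 : 1 ≤ M ^ (-(s / 2)) * R ^ (s / 2) := by
        rw [Real.rpow_neg hM.le, inv_mul_eq_div, one_le_div (Real.rpow_pos_of_pos hM _)]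
        exact Real.rpow_le_rpow hM.le (h.trans hR) (half_pos hs).le
      rw [e1, ← mul_assoc]
      exact le_mul_of_one_le_left (Real.rpow_pos_of_pos hR0 _).le e2
    have h3 : a * Real.log (a / b) ≤ a * (2 / s * (M ^ (-(s / 2)) * R ^ s)) := by
      refine mul_le_mul_of_nonneg_left (h1.trans ?_) ha.le
      rw [show R ^ (s / 2) / (s / 2) = 2 / s * R ^ (s / 2) by field_simp]
      gcongr
    have h4 : 0 ≤ M * |a - b| := by positivity
    linarith

lemma neg_abs_sub_le_mul_log_div {a b : ℝ} (ha : 0 < a) (hb : 0 < b) :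
    -|a - b| ≤ a * Real.log (a / b) := by
  have h1 : Real.log (b / a) ≤ b / a - 1 := Real.log_le_sub_one_of_pos (div_pos hb ha)
  have h2 : Real.log (a / b) = -Real.log (b / a) := by rw [← Real.log_inv, inv_div]
  have h3 : a * (b / a - 1) = b - a := by field_simp
  have h4 := mul_le_mul_of_nonneg_left h1 ha.le
  rw [h2]
  linarith [neg_abs_le (a - b)]

/-- Densities on `(0,1)` that are close in `L¹` and whose likelihood ratio has a finite moment
are close in Kullback–Leibler divergence. -/
lemma integrableOn_and_integral_mul_log_div_le {f g H : ℝ → ℝ} {k M s : ℝ}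
    (hf : IntegrableOn f (Ioo (0:ℝ) 1)) (hg : IntegrableOn g (Ioo (0:ℝ) 1))
    (hH : IntegrableOn H (Ioo (0:ℝ) 1)) (hM : 1 ≤ M) (hs : 0 < s)
    (hfpos : ∀ x ∈ Ioo (0:ℝ) 1, 0 < f x) (hgpos : ∀ x ∈ Ioo (0:ℝ) 1, 0 < g x)
    (hR : ∀ x ∈ Ioo (0:ℝ) 1, ∃ R, f x / g x ≤ R ∧ f x * R ^ s = k * H x) :
    IntegrableOn (fun x => f x * Real.log (f x / g x)) (Ioo (0:ℝ) 1) ∧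
      ∫ x in Ioo (0:ℝ) 1, f x * Real.log (f x / g x) ≤
        M * (∫ x in Ioo (0:ℝ) 1, |f x - g x|) +
          2 / s * M ^ (-(s / 2)) * (k * ∫ x in Ioo (0:ℝ) 1, H x) := by
  have hM0 : 0 < M := one_pos.trans_le hM
  have hup : ∀ x ∈ Ioo (0:ℝ) 1, f x * Real.log (f x / g x) ≤
      M * |f x - g x| + 2 / s * M ^ (-(s / 2)) * (k * H x) := by
    intro x hx
    obtain ⟨R, h1, h2⟩ := hR x hx
    rw [← h2]
    exact mul_log_div_le_s3 (hfpos x hx) (hgpos x hx) hM0 hs h1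
  have hnn : ∀ x ∈ Ioo (0:ℝ) 1, 0 ≤ 2 / s * M ^ (-(s / 2)) * (k * H x) := by
    intro x hx
    obtain ⟨R, h1, h2⟩ := hR x hx
    have := hfpos x hx
    have hR0 : 0 < R := (div_pos this (hgpos x hx)).trans_le h1
    rw [← h2]
    positivity
  have i1 : IntegrableOn (fun x => M * |f x - g x|) (Ioo (0:ℝ) 1) :=
    (hf.sub hg).abs.const_mul M
  have i2 : IntegrableOn (fun x => 2 / s * M ^ (-(s / 2)) * (k * H x)) (Ioo (0:ℝ) 1) :=
    (hH.const_mul k).const_mul _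
  have hint : IntegrableOn (fun x => f x * Real.log (f x / g x)) (Ioo (0:ℝ) 1) := by
    refine Integrable.mono' (i1.add i2) ?_ ?_
    · exact (hf.aemeasurable.mul
        (Real.measurable_log.comp_aemeasurable (hf.aemeasurable.div hg.aemeasurable))
        ).aestronglyMeasurable
    · refine ae_restrict_of_forall_mem measurableSet_Ioo fun x hx => ?_
      have h1 := neg_abs_sub_le_mul_log_div (hfpos x hx) (hgpos x hx)
      have h2 : |f x - g x| ≤ M * |f x - g x| := le_mul_of_one_le_left (abs_nonneg _) hM
      rw [Real.norm_eq_abs, abs_le]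
      exact ⟨by simp only [Pi.add_apply]; linarith [hnn x hx], hup x hx⟩
  refine ⟨hint, (setIntegral_mono_on hint (i1.add i2) measurableSet_Ioo hup).trans_eq ?_⟩
  rw [integral_add' i1 i2, integral_const_mul, integral_const_mul, integral_const_mul]

/-- An `L¹` bound for the difference of two two-component mixtures. -/
lemma integral_abs_mixture_sub_le {b₀ b₁ g₀ g₁ : ℝ → ℝ} {w₀ w₁ : ℝ} (hw₀ : w₀ ∈ Ioo (0:ℝ) 1)
    (hb₀ : IntegrableOn b₀ (Ioo (0:ℝ) 1)) (hb₁ : IntegrableOn b₁ (Ioo (0:ℝ) 1))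
    (hg₀ : IntegrableOn g₀ (Ioo (0:ℝ) 1)) (hg₁ : IntegrableOn g₁ (Ioo (0:ℝ) 1))
    (hb₁0 : ∀ x ∈ Ioo (0:ℝ) 1, 0 ≤ b₁ x) (hg₁0 : ∀ x ∈ Ioo (0:ℝ) 1, 0 ≤ g₁ x)
    (ib₁ : ∫ x in Ioo (0:ℝ) 1, b₁ x = 1) (ig₁ : ∫ x in Ioo (0:ℝ) 1, g₁ x = 1) :
    ∫ x in Ioo (0:ℝ) 1, |(w₀ * b₀ x + (1 - w₀) * g₀ x) - (w₁ * b₁ x + (1 - w₁) * g₁ x)| ≤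
      (∫ x in Ioo (0:ℝ) 1, |b₀ x - b₁ x|) + (∫ x in Ioo (0:ℝ) 1, |g₁ x - g₀ x|) +
        2 * |w₁ - w₀| := by
  have i1 : IntegrableOn (fun x => |b₀ x - b₁ x|) (Ioo (0:ℝ) 1) := (hb₀.sub hb₁).abs
  have i2 : IntegrableOn (fun x => |g₁ x - g₀ x|) (Ioo (0:ℝ) 1) := (hg₁.sub hg₀).abs
  have i3 : IntegrableOn (fun x => |w₁ - w₀| * (b₁ x + g₁ x)) (Ioo (0:ℝ) 1) :=
    (hb₁.add hg₁).const_mul _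
  have i0 : IntegrableOn (fun x =>
      |(w₀ * b₀ x + (1 - w₀) * g₀ x) - (w₁ * b₁ x + (1 - w₁) * g₁ x)|) (Ioo (0:ℝ) 1) :=
    (((hb₀.const_mul _).add (hg₀.const_mul _)).sub
      ((hb₁.const_mul _).add (hg₁.const_mul _))).abs
  refine (setIntegral_mono_on i0 ((i1.add i2).add i3) measurableSet_Ioo fun x hx => ?_).trans_eq ?_
  · have e : (w₀ * b₀ x + (1 - w₀) * g₀ x) - (w₁ * b₁ x + (1 - w₁) * g₁ x) =
        w₀ * (b₀ x - b₁ x) - (1 - w₀) * (g₁ x - g₀ x) + (w₁ - w₀) * (g₁ x - b₁ x) := by ring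
    have t1 : |w₀ * (b₀ x - b₁ x)| ≤ |b₀ x - b₁ x| := by
      rw [abs_mul, abs_of_pos hw₀.1]
      exact mul_le_of_le_one_left (abs_nonneg _) hw₀.2.le
    have t2 : |(1 - w₀) * (g₁ x - g₀ x)| ≤ |g₁ x - g₀ x| := by
      rw [abs_mul, abs_of_pos (sub_pos.2 hw₀.2)]
      exact mul_le_of_le_one_left (abs_nonneg _) (by linarith [hw₀.1])
    have t3 : |(w₁ - w₀) * (g₁ x - b₁ x)| ≤ |w₁ - w₀| * (b₁ x + g₁ x) := by
      rw [abs_mul]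
      refine mul_le_mul_of_nonneg_left ?_ (abs_nonneg _)
      rw [abs_le]
      constructor <;> linarith [hb₁0 x hx, hg₁0 x hx]
    rw [e]
    simp only [Pi.add_apply]
    linarith [abs_add_le (w₀ * (b₀ x - b₁ x) - (1 - w₀) * (g₁ x - g₀ x))
      ((w₁ - w₀) * (g₁ x - b₁ x)), abs_sub (w₀ * (b₀ x - b₁ x)) ((1 - w₀) * (g₁ x - g₀ x))]
  · rw [integral_add' (i1.add i2) i3, integral_add' i1 i2, integral_const_mul,
      integral_add hb₁ hg₁, ib₁, ig₁]
    ring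

/-- A polynomial lower bound for the reparametrized beta density, uniform over parameters within
`η` of `(μ₀, ν₀)`. -/
lemma le_betaStar {μ₀ ν₀ μ ν η c x : ℝ} (hμ : |μ - μ₀| ≤ η) (hν : |ν - ν₀| ≤ η)
    (hp : (μ, ν) ∈ Ioo (0:ℝ) 1 ×ˢ Ioi (0:ℝ)) (hx : x ∈ Ioo (0:ℝ) 1)
    (hc0 : 0 ≤ c) (hc : c ≤ betaNorm (μ, ν)) :
    c * (x ^ ((μ₀ + η) * (ν₀ + η) - 1) * (1 - x) ^ ((1 - μ₀ + η) * (ν₀ + η) - 1)) ≤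
      betaStar μ ν x := by
  obtain ⟨⟨h0, h1⟩, h2⟩ := hp
  have h0 : 0 < μ := h0
  have h1 : μ < 1 := h1
  have h2 : 0 < ν := h2
  rw [abs_le] at hμ hν
  have hx' : 0 < 1 - x := sub_pos.2 hx.2
  have e1 : x ^ ((μ₀ + η) * (ν₀ + η) - 1) ≤ x ^ (μ * ν - 1) := by
    refine Real.rpow_le_rpow_of_exponent_ge hx.1 hx.2.le (sub_le_sub_right ?_ 1)
    exact mul_le_mul (by linarith) (by linarith) h2.le (by linarith)
  have e2 : (1 - x) ^ ((1 - μ₀ + η) * (ν₀ + η) - 1) ≤ (1 - x) ^ ((1 - μ) * ν - 1) := by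
    refine Real.rpow_le_rpow_of_exponent_ge hx' (by linarith [hx.1]) (sub_le_sub_right ?_ 1)
    exact mul_le_mul (by linarith) (by linarith) h2.le (by linarith)
  rw [betaStar_eq, ← mul_assoc]
  have hx0 := hx.1
  have hN := hc0.trans hc
  gcongr

lemma mul_div_rpow_eq {a x y c s A B : ℝ} (ha : 0 < a) (hx : 0 < x) (hy : 0 < y) (hc : 0 < c) :
    a * (a / (c * (x ^ A * y ^ B))) ^ s =
      c ^ (-s) * (a ^ (s + 1) / (x ^ (s * A) * y ^ (s * B))) := by
  have hxA := Real.rpow_pos_of_pos hx A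
  have hyB := Real.rpow_pos_of_pos hy B
  rw [Real.div_rpow ha.le (by positivity), Real.mul_rpow hc.le (by positivity),
    Real.mul_rpow hxA.le hyB.le, ← Real.rpow_mul hx.le, ← Real.rpow_mul hy.le, mul_comm A,
    mul_comm B, Real.rpow_add_one ha.ne', Real.rpow_neg hc.le]
  have := Real.rpow_pos_of_pos hc s
  field_simp

/-- The analytic core of the proof of Theorem S.3: local Kullback–Leibler continuity of
beta mixtures around `u₀ = w₀ b*_{μ₀,ν₀} + (1−w₀) u_{P₀}`. -/
theorem beta_mixture_KL_continuity
    (μ₀ ν₀ w₀ : ℝ) (hμ₀ : μ₀ ∈ Ioo (0:ℝ) 1) (hν₀ : 0 < ν₀) (hw₀ : w₀ ∈ Ioo (0:ℝ) 1)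
    (P₀ : Measure (ℝ × ℝ)) (hP₀ : IsProbabilityMeasure P₀)
    (hP₀s : P₀ (Ioo (0:ℝ) 1 ×ˢ Ioi (0:ℝ)) = 1)
    (u₀ : ℝ → ℝ)
    (hu₀ : ∀ x, u₀ x = w₀ * betaStar μ₀ ν₀ x + (1 - w₀) * betaMix P₀ x)
    (ζ η : ℝ) (hζ : 0 < ζ) (hη0 : 0 < η)
    (hη : η < min (min μ₀ (1 - μ₀)) (min ν₀ w₀))
    -- ∫₀¹ u₀^{ζ+1} / (x^{ζA} (1−x)^{ζB}) dx < ∞, A = (μ₀+η)(ν₀+η)−1, B = (1−μ₀+η)(ν₀+η)−1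
    (hmom : IntegrableOn (fun x => u₀ x ^ (ζ + 1) /
        (x ^ (ζ * ((μ₀ + η) * (ν₀ + η) - 1)) *
          (1 - x) ^ (ζ * ((1 - μ₀ + η) * (ν₀ + η) - 1))))
      (Ioo (0:ℝ) 1)) :
    ∀ ε > 0, ∃ η'' : ℝ, 0 < η'' ∧ η'' ≤ η ∧ ∃ η' > 0,
      ∀ w₁ μ₁ ν₁ : ℝ, |w₁ - w₀| ≤ η'' → |μ₁ - μ₀| ≤ η'' → |ν₁ - ν₀| ≤ η'' →
        ∀ G₁ : Measure (ℝ × ℝ), IsProbabilityMeasure G₁ →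
          G₁ (Ioo (0:ℝ) 1 ×ˢ Ioi (0:ℝ)) = 1 →
          (∫ x in Ioo (0:ℝ) 1, |betaMix G₁ x - betaMix P₀ x|) ≤ η' →
          (IntegrableOn (fun x => u₀ x * Real.log (u₀ x /
              (w₁ * betaStar μ₁ ν₁ x + (1 - w₁) * betaMix G₁ x))) (Ioo (0:ℝ) 1) ∧
            ∫ x in Ioo (0:ℝ) 1, u₀ x * Real.log (u₀ x /
              (w₁ * betaStar μ₁ ν₁ x + (1 - w₁) * betaMix G₁ x)) ≤ ε) := by
  intro ε hε
  have hp₀ : (μ₀, ν₀) ∈ Ioo (0:ℝ) 1 ×ˢ Ioi (0:ℝ) := ⟨hμ₀, hν₀⟩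
  have hN₀ := betaNorm_pos hp₀
  have hw0 := hw₀.1
  set c : ℝ := w₀ / 2 * (betaNorm (μ₀, ν₀) / 2) with hc
  have hc0 : 0 < c := by positivity
  set K : ℝ := c ^ (-ζ) * ∫ x in Ioo (0:ℝ) 1, u₀ x ^ (ζ + 1) /
        (x ^ (ζ * ((μ₀ + η) * (ν₀ + η) - 1)) *
          (1 - x) ^ (ζ * ((1 - μ₀ + η) * (ν₀ + η) - 1))) with hK
  obtain ⟨M, hMK, hM1⟩ : ∃ M : ℝ, 2 / ζ * M ^ (-(ζ / 2)) * K < ε / 2 ∧ 1 ≤ M := by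
    have ht : Tendsto (fun M : ℝ => 2 / ζ * M ^ (-(ζ / 2)) * K) atTop (𝓝 0) := by
      simpa using ((tendsto_rpow_neg_atTop (half_pos hζ)).const_mul (2 / ζ)).mul_const K
    exact ((ht.eventually (gt_mem_nhds (half_pos hε))).and (eventually_ge_atTop 1)).exists
  have hM0 : 0 < M := one_pos.trans_le hM1
  set δ : ℝ := ε / (8 * M) with hδ
  have hδ0 : 0 < δ := by positivity
  have hD : ∀ᶠ p in 𝓝 (μ₀, ν₀), p ∈ Ioo (0:ℝ) 1 ×ˢ Ioi (0:ℝ) :=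
    (isOpen_Ioo.prod isOpen_Ioi).mem_nhds hp₀
  have hev : ∀ᶠ p : ℝ × ℝ in 𝓝 (μ₀, ν₀), p ∈ Ioo (0:ℝ) 1 ×ˢ Ioi (0:ℝ) ∧
      betaNorm (μ₀, ν₀) / 2 < betaNorm p ∧
      ∫ x in Ioo (0:ℝ) 1, |betaStar μ₀ ν₀ x - betaStar p.1 p.2 x| < δ :=
    hD.and (((continuousAt_betaNorm hp₀).eventually (lt_mem_nhds (half_lt_self hN₀))).and
    ((tendsto_integral_abs_betaStar_sub hp₀).eventually (gt_mem_nhds hδ0)))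
  obtain ⟨r, hr0, hr⟩ := Metric.eventually_nhds_iff.1 hev
  set ρ : ℝ := min (min η (r / 2)) (min (min (w₀ / 2) (1 - w₀)) δ)
  have hρη : ρ ≤ η := (min_le_left _ _).trans (min_le_left _ _)
  have hρr : ρ ≤ r / 2 := (min_le_left _ _).trans (min_le_right _ _)
  have hρw : ρ ≤ w₀ / 2 := ((min_le_right _ _).trans (min_le_left _ _)).trans (min_le_left _ _)
  have hρw' : ρ ≤ 1 - w₀ := ((min_le_right _ _).trans (min_le_left _ _)).trans (min_le_right _ _)
  have hρδ : ρ ≤ δ := (min_le_right _ _).trans (min_le_right _ _)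
  refine ⟨ρ, lt_min (lt_min hη0 (half_pos hr0))
    (lt_min (lt_min (half_pos hw0) (sub_pos.2 hw₀.2)) hδ0), hρη, δ, hδ0, ?_⟩
  intro w₁ μ₁ ν₁ hw hμ hν G₁ _ hG₁s hG
  obtain ⟨hp₁, hN₁, hL1⟩ := hr (y := (μ₁, ν₁)) (by
    rw [Prod.dist_eq, Real.dist_eq, Real.dist_eq]
    exact (max_le hμ hν).trans_lt (by linarith))
  have hw' := abs_le.1 hw
  have hw₁ : w₀ / 2 ≤ w₁ := by linarith
  have hw₁' : 0 ≤ 1 - w₁ := by linarith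
  obtain rfl : u₀ = fun x => w₀ * betaStar μ₀ ν₀ x + (1 - w₀) * betaMix P₀ x := funext hu₀
  have hupos : ∀ x ∈ Ioo (0:ℝ) 1, 0 < w₀ * betaStar μ₀ ν₀ x + (1 - w₀) * betaMix P₀ x :=
    fun x hx => add_pos_of_pos_of_nonneg (mul_pos hw0 (betaStar_pos hp₀ hx))
      (mul_nonneg (sub_pos.2 hw₀.2).le (betaMix_nonneg hP₀s hx))
  have hlow : ∀ x ∈ Ioo (0:ℝ) 1,
      c * (x ^ ((μ₀ + η) * (ν₀ + η) - 1) * (1 - x) ^ ((1 - μ₀ + η) * (ν₀ + η) - 1)) ≤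
        w₁ * betaStar μ₁ ν₁ x + (1 - w₁) * betaMix G₁ x := by
    intro x hx
    have h1 := le_betaStar (hμ.trans hρη) (hν.trans hρη) hp₁ hx (half_pos hN₀).le hN₁.le
    have h2 : w₀ / 2 * betaStar μ₁ ν₁ x ≤ w₁ * betaStar μ₁ ν₁ x :=
      mul_le_mul_of_nonneg_right hw₁ (betaStar_pos hp₁ hx).le
    have h3 := mul_nonneg hw₁' (betaMix_nonneg hG₁s hx)
    have h4 := mul_le_mul_of_nonneg_left h1 (half_pos hw0).le
    rw [← mul_assoc, ← hc] at h4
    linarith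
  have hlow0 : ∀ x ∈ Ioo (0:ℝ) 1,
      0 < c * (x ^ ((μ₀ + η) * (ν₀ + η) - 1) * (1 - x) ^ ((1 - μ₀ + η) * (ν₀ + η) - 1)) :=
    fun x hx => mul_pos hc0
      (mul_pos (Real.rpow_pos_of_pos hx.1 _) (Real.rpow_pos_of_pos (sub_pos.2 hx.2) _))
  have ib₀ := integrableOn_betaStar hp₀
  have ib₁ := integrableOn_betaStar hp₁
  have ig₀ := integrableOn_betaMix hP₀s
  have ig₁ := integrableOn_betaMix hG₁s
  obtain ⟨h1, h2⟩ := integrableOn_and_integral_mul_log_div_le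
    (f := fun x => w₀ * betaStar μ₀ ν₀ x + (1 - w₀) * betaMix P₀ x)
    (g := fun x => w₁ * betaStar μ₁ ν₁ x + (1 - w₁) * betaMix G₁ x)
    (k := c ^ (-ζ)) ((ib₀.const_mul _).add (ig₀.const_mul _))
    ((ib₁.const_mul _).add (ig₁.const_mul _)) hmom hM1 hζ
    hupos (fun x hx => (hlow0 x hx).trans_le (hlow x hx))
    (fun x hx => ⟨_, div_le_div_of_nonneg_left (hupos x hx).le (hlow0 x hx) (hlow x hx),
      mul_div_rpow_eq (hupos x hx) hx.1 (sub_pos.2 hx.2) hc0⟩)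
  refine ⟨h1, h2.trans ?_⟩
  have hL := integral_abs_mixture_sub_le (w₁ := w₁) hw₀ ib₀ ib₁ ig₀ ig₁
    (fun x hx => (betaStar_pos hp₁ hx).le) (fun x hx => betaMix_nonneg hG₁s hx)
    (integral_betaStar hp₁) (integral_betaMix hG₁s)
  have hM4 : M * (4 * δ) = ε / 2 := by
    rw [hδ]
    field_simp
    norm_num
  have hML := mul_le_mul_of_nonneg_left
    (hL.trans (show _ ≤ 4 * δ by linarith [hw.trans hρδ])) hM0.le
  linarith
end
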